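/- (τ-method inclusion sets, Theorem 1.1) For every ε ≥ 0 and every n ∈ {1, …, N−1}, the closed ε-pseudospectrum of A is contained in the τ-method inclusion set: Spec_ε A ⊆ Σ^n_ε(A); in particular Spec A ⊆ Σ^n_0(A). -/

import Mathlib

open scoped Real

noncomputable section

namespace SpecIncl

/-- The smallest singular value of a (possibly rectangular) complex matrix,
as the infimum of `‖F x‖` over the unit sphere. -/
noncomputable def sval {ι κ : Type*} [Fintype ι] [Fintype κ] [DecidableEq κ]
    (F : Matrix ι κ ℂ) : ℝ :=
  sInf {y : ℝ | ∃ x : EuclideanSpace ℂ κ, ‖x‖ = 1 ∧ y = ‖Matrix.toEuclideanLin F x‖}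

/-- The spectral norm (2-norm) of a complex matrix. -/
noncomputable def opNorm {ι κ : Type*} [Fintype ι] [Fintype κ] [DecidableEq κ]
    (F : Matrix ι κ ℂ) : ℝ :=
  sSup {y : ℝ | ∃ x : EuclideanSpace ℂ κ, ‖x‖ = 1 ∧ y = ‖Matrix.toEuclideanLin F x‖}

/-- The closed ε-pseudospectrum of a square complex matrix. -/
noncomputable def pspec {ι : Type*} [Fintype ι] [DecidableEq ι] (ε : ℝ)
    (E : Matrix ι ι ℂ) : Set ℂ :=
  {z : ℂ | sval (E - z • (1 : Matrix ι ι ℂ)) ≤ ε}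

/-- Assemble blocks into a block matrix indexed by a sigma type. -/
def blockMat {N : ℕ} (m : Fin N → ℕ)
    (a : ∀ i j : Fin N, Matrix (Fin (m i)) (Fin (m j)) ℂ) :
    Matrix ((i : Fin N) × Fin (m i)) ((j : Fin N) × Fin (m j)) ℂ :=
  fun p q => a p.1 q.1 p.2 q.2

/-- The block-tridiagonal part of a block matrix. -/
def triPart {N : ℕ} {m : Fin N → ℕ}
    (a : ∀ i j : Fin N, Matrix (Fin (m i)) (Fin (m j)) ℂ) :
    ∀ i j : Fin N, Matrix (Fin (m i)) (Fin (m j)) ℂ :=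
  fun i j => if |(i : ℤ) - (j : ℤ)| ≤ 1 then a i j else 0

/-- The remaining (off-tridiagonal) part of a block matrix. -/
def remPart {N : ℕ} {m : Fin N → ℕ}
    (a : ∀ i j : Fin N, Matrix (Fin (m i)) (Fin (m j)) ℂ) :
    ∀ i j : Fin N, Matrix (Fin (m i)) (Fin (m j)) ℂ :=
  fun i j => if |(i : ℤ) - (j : ℤ)| ≤ 1 then 0 else a i j

/-- r_L(A): max of the norms of the first-subdiagonal blocks. -/
noncomputable def rL {N : ℕ} {m : Fin N → ℕ}
    (a : ∀ i j : Fin N, Matrix (Fin (m i)) (Fin (m j)) ℂ) : ℝ :=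
  sSup {y : ℝ | ∃ i j : Fin N, (j : ℕ) + 1 = (i : ℕ) ∧ y = opNorm (a i j)}

/-- r_U(A): max of the norms of the first-superdiagonal blocks. -/
noncomputable def rU {N : ℕ} {m : Fin N → ℕ}
    (a : ∀ i j : Fin N, Matrix (Fin (m i)) (Fin (m j)) ℂ) : ℝ :=
  sSup {y : ℝ | ∃ i j : Fin N, (i : ℕ) + 1 = (j : ℕ) ∧ y = opNorm (a i j)}

noncomputable def rA {N : ℕ} {m : Fin N → ℕ}
    (a : ∀ i j : Fin N, Matrix (Fin (m i)) (Fin (m j)) ℂ) : ℝ :=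
  rL a + rU a

/-- θ_n for the coefficient `c = r_L r_U / r²`: the unique solution of
`2 sin(t/2) cos((n+1/2)t) + c sin((n−1)t) = 0` in `[π/(2n+1), π/(n+2)]`
(by uniqueness, equal to the infimum of the solution set). -/
noncomputable def theta (c : ℝ) (n : ℕ) : ℝ :=
  sInf {t : ℝ | t ∈ Set.Icc (Real.pi / (2 * (n : ℝ) + 1)) (Real.pi / ((n : ℝ) + 2)) ∧
    2 * Real.sin (t / 2) * Real.cos (((n : ℝ) + 1 / 2) * t)
      + c * Real.sin (((n : ℝ) - 1) * t) = 0}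

/-- ε_n(A) := 2 r(A) sin(θ_n(A)/2) + ‖C‖. -/
noncomputable def epsTau {N : ℕ} {m : Fin N → ℕ}
    (a : ∀ i j : Fin N, Matrix (Fin (m i)) (Fin (m j)) ℂ) (n : ℕ) : ℝ :=
  2 * rA a * Real.sin (theta (rL a * rU a / (rA a) ^ 2) n / 2)
    + opNorm (blockMat m (remPart a))

/-- The index `k + i` in `Fin N` (0-based window of length `n` starting at `k`). -/
def widx {N n k : ℕ} (h : k + n ≤ N) (i : Fin n) : Fin N :=
  ⟨k + i, by have := i.isLt; omega⟩

/-- The principal submatrix `B_{n,k}` of a block matrix, with block rows and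
columns `k+1,…,k+n` (1-based), i.e. `k,…,k+n-1` (0-based). -/
def window {N : ℕ} {m : Fin N → ℕ}
    (b : ∀ i j : Fin N, Matrix (Fin (m i)) (Fin (m j)) ℂ)
    (n k : ℕ) (h : k + n ≤ N) :
    Matrix ((i : Fin n) × Fin (m (widx h i))) ((j : Fin n) × Fin (m (widx h j))) ℂ :=
  fun p q => b (widx h p.1) (widx h q.1) p.2 q.2

/-- σ^n_ε(A) of the τ-method. -/
noncomputable def sigmaLow {N : ℕ} {m : Fin N → ℕ}
    (a : ∀ i j : Fin N, Matrix (Fin (m i)) (Fin (m j)) ℂ)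
    (n : ℕ) (h : n ≤ N) (ε : ℝ) : Set ℂ :=
  (⋃ k : Fin (N - n + 1),
      pspec (ε + epsTau a n)
        (window (triPart a) n k (by have := k.isLt; omega))) ∪
  (⋃ m' : Fin (n - 1),
      pspec (ε + epsTau a n)
        (window (triPart a) (m' + 1) 0 (by have := m'.isLt; omega)) ∪
      pspec (ε + epsTau a n)
        (window (triPart a) (m' + 1) (N - (m' + 1)) (by have := m'.isLt; omega)))

/-- σ̂^n_ε(A) of the τ-method. -/
noncomputable def sigmaHat {N : ℕ} {m : Fin N → ℕ}
    (a : ∀ i j : Fin N, Matrix (Fin (m i)) (Fin (m j)) ℂ)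
    (n : ℕ) (h : n ≤ N) (ε : ℝ) : Set ℂ :=
  ⋃ k : Fin (N - n + 1),
    pspec (ε + epsTau a (n - 2))
      (window (triPart a) n k (by have := k.isLt; omega))

/-- The τ-method inclusion set Σ^n_ε(A). -/
noncomputable def SigmaTau {N : ℕ} {m : Fin N → ℕ}
    (a : ∀ i j : Fin N, Matrix (Fin (m i)) (Fin (m j)) ℂ)
    (n : ℕ) (h : n ≤ N) (ε : ℝ) : Set ℂ :=
  if n ≤ 2 then sigmaLow a n h ε else sigmaLow a n h ε ∩ sigmaHat a n h ε

end SpecIncl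

section auxiliary

open Finset

/-- Summation by parts of the local balance between `U` and `V` against the weights `τ`. -/
theorem sum_weighted_balance (N : ℕ) (s : ℝ) (τ U V x y : ℕ → ℝ)
    (hx1 : x 1 = 0) (hxN : x (N + 1) = 0) (hy0 : y 0 = 0) (hyN : y N = 0)
    (hloc : ∀ i < N, s * (U (i + 1) ^ 2 - V (i + 1) ^ 2)
      = x (i + 1) + y (i + 1) - x (i + 2) - y i) :
    ∑ i ∈ range N, τ (i + 1) * (s * (U (i + 1) ^ 2 - V (i + 1) ^ 2))
      = ∑ i ∈ range N, ((τ (i + 1) - τ i) * x (i + 1) + (τ (i + 1) - τ (i + 2)) * y (i + 1)) := by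
  have h1 : ∀ K, ∑ i ∈ range K, (τ (i + 1) * (x (i + 1) + y (i + 1) - x (i + 2) - y i)
      - ((τ (i + 1) - τ i) * x (i + 1) + (τ (i + 1) - τ (i + 2)) * y (i + 1)))
      = τ 0 * x 1 - τ K * x (K + 1) - τ 1 * y 0 + τ (K + 1) * y K := by
    intro K
    induction K with
    | zero => simp
    | succ K ih => rw [sum_range_succ, ih]; ring
  have h2 := h1 N
  rw [hx1, hxN, hy0, hyN, sum_sub_distrib] at h2
  rw [sum_congr rfl fun i hi => by rw [hloc i (mem_range.1 hi)]]
  linarith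

theorem sum_shift_down (N : ℕ) (c V : ℕ → ℝ) (hV : V 0 = 0) (hc : ∀ i, 0 ≤ c i) :
    ∑ i ∈ range N, c i * V i ^ 2 ≤ ∑ i ∈ range N, c (i + 1) * V (i + 1) ^ 2 := by
  have := sum_range_succ' (fun i => c i * V i ^ 2) N
  rw [sum_range_succ] at this
  simp only [hV] at this
  nlinarith [mul_nonneg (hc N) (sq_nonneg (V N))]

theorem sum_shift_up (N : ℕ) (c V : ℕ → ℝ) (hV : V (N + 1) = 0) (hc : ∀ i, 0 ≤ c i) :
    ∑ i ∈ range N, c (i + 1) * V (i + 2) ^ 2 ≤ ∑ i ∈ range N, c i * V (i + 1) ^ 2 := by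
  have := sum_range_succ' (fun i => c i * V (i + 1) ^ 2) N
  rw [sum_range_succ] at this
  simp only [hV] at this
  nlinarith [mul_nonneg (hc 0) (sq_nonneg (V 1))]

theorem abs_cross_le {a α p U V x : ℝ} (ha : |a| ≤ p) (hx : |x| ≤ α * (U * V))
    (hα : 0 ≤ α) : a * x ≤ α * p * (U ^ 2 + V ^ 2) / 2 := by
  have hp : 0 ≤ p := (abs_nonneg a).trans ha
  have h1 : a * x ≤ p * (α * (U * V)) :=
    (le_abs_self _).trans (by rw [abs_mul]; exact mul_le_mul ha hx (abs_nonneg _) hp)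
  nlinarith [mul_nonneg (mul_nonneg hα hp) (sq_nonneg (U - V))]

set_option maxHeartbeats 4000000 in
/-- The sum of the row functionals over a family of cut-offs, expressed through the diagonal sums
`Φ`, the sums of squared increments `P` and their parts `CA`, `CC` inside the windows, is at most
`(s + M) ^ 2` times the total mass of the family. -/
theorem sum_row_le_of_aggregates {N n : ℕ} {α β s M S Y ω f e H Ub Vb : ℝ}
    (hα : 0 ≤ α) (hβ : 0 ≤ β) (hαβ : α + β = 1) (hs : 0 ≤ s) (hM : 0 ≤ M)
    (hY : 0 ≤ Y) (hω : 0 ≤ ω) (hf : 0 ≤ f) (he : 0 ≤ e) (hH : 0 ≤ H) (hfω : f ≤ ω)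
    {U V x y Φ P CA CC : ℕ → ℝ}
    (hU0 : U 0 = 0) (hV0 : V 0 = 0) (hUN : U (N + 1) = 0) (hVN : V (N + 1) = 0)
    (hx : ∀ i ≤ N, |x (i + 1)| ≤ α * (U (i + 1) * V i))
    (hy : ∀ i ≤ N, |y i| ≤ β * (U i * V (i + 1)))
    (hloc : ∀ i < N, s * (U (i + 1) ^ 2 - V (i + 1) ^ 2)
      = x (i + 1) + y (i + 1) - x (i + 2) - y i)
    (hΦ : ∀ i < N, S ≤ Φ (i + 1))
    (hP0 : ∀ i, 0 ≤ P i)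
    (hPl : ∀ i < n, P (i + 1) ≤ Y + f)
    (hPn1 : ω + e ≤ P (n + 1)) (hPn2 : P (n + 1) ≤ ω + e + Y)
    (hPr : ∀ i, n < i → P (i + 1) ≤ Y + ω)
    (hCAl : ∀ i < n, CA (i + 1) ≤ Y + f) (hCAr : ∀ i, n ≤ i → CA (i + 1) ≤ Y)
    (hCCl : ∀ i, i + 1 < n → CC (i + 1) ≤ Y + f) (hCCn : CC n ≤ Y + H)
    (hCCr : ∀ i, n < i → CC i ≤ Y + ω)
    (hU1 : (Y + ω) / 2 ≤ Ub)
    (hU2 : s * e + β * e + (Y + α * f + β * ω) / 2 ≤ Ub)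
    (hV1 : (Y + ω) / 2 ≤ Vb)
    (hV2 : s * ((Y + f) / 2) + Y + f ≤ s * Vb + s ^ 2 * e + M ^ 2 * S)
    (hV3 : s * ((Y + ω) / 2 + β * e) + Y + β * H ≤ s * Vb + M ^ 2 * S)
    (hYS : Y + β * ω ≤ M ^ 2 * S)
    (hUV : Ub + Vb ≤ 2 * M * S) :
    ∑ i ∈ range N, (s ^ 2 * (Φ (i + 1) * U (i + 1) ^ 2)
        + s * ((Φ i - Φ (i + 1) - P (i + 1)) * x (i + 1)
          + (Φ (i + 2) - Φ (i + 1) - P (i + 2)) * y (i + 1))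
        + α * CA (i + 1) * V i ^ 2 + β * CC (i + 1) * V (i + 2) ^ 2)
      ≤ (s + M) ^ 2 * ∑ i ∈ range N, Φ (i + 1) * V (i + 1) ^ 2 := by
  classical
  have hx1 : x 1 = 0 := by simpa [hV0] using hx 0 (Nat.zero_le _)
  have hxN : x (N + 1) = 0 := by simpa [hUN] using hx N le_rfl
  have hy0 : y 0 = 0 := by simpa [hU0] using hy 0 (Nat.zero_le _)
  have hyN : y N = 0 := by simpa [hVN] using hy N le_rfl
  set τ : ℕ → ℝ := fun i => if i ≤ n then e else 0 with hτ
  have key := sum_weighted_balance N s (fun i => Φ i - τ i) U V x y hx1 hxN hy0 hyN hloc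
  have bal := sum_weighted_balance N s (fun _ => 1) U V x y hx1 hxN hy0 hyN hloc
  simp only [sub_self, zero_mul, add_zero, sum_const_zero, one_mul] at bal
  set pA : ℕ → ℝ := fun i => if i < n then Y + f else Y + ω with hpA
  set qC : ℕ → ℝ := fun r => if r < n then Y + f else if r = n then Y + ω + 2 * e else Y + ω
    with hqC
  set cA : ℕ → ℝ := fun i => if i < n then Y + f else Y with hcA
  set cC : ℕ → ℝ := fun r => if r < n then Y + f else if r = n then Y + H else Y + ω with hcC
  have pA0 : ∀ i, 0 ≤ pA i := fun i => by simp only [hpA]; split_ifs <;> linarith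
  have qC0 : ∀ i, 0 ≤ qC i := fun i => by simp only [hqC]; split_ifs <;> linarith
  have cA0 : ∀ i, 0 ≤ cA i := fun i => by simp only [hcA]; split_ifs <;> linarith
  have cC0 : ∀ i, 0 ≤ cC i := fun i => by simp only [hcC]; split_ifs <;> linarith
  have hA : ∀ i, |τ i - τ (i + 1) - P (i + 1)| ≤ pA i := by
    intro i
    have := hP0 (i + 1)
    rcases lt_trichotomy i n with h | h | h
    · have := hPl i h
      simp only [hτ, hpA, h, h.le, Nat.succ_le_of_lt h, if_true]
      rw [abs_le]; constructor <;> linarith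
    · subst h
      simp only [hτ, hpA, le_refl, lt_irrefl, if_true, if_false]
      rw [if_neg (by omega), abs_le]; constructor <;> linarith
    · have := hPr i h
      simp only [hτ, hpA]
      rw [if_neg (by omega), if_neg (by omega), if_neg (by omega), abs_le]
      constructor <;> linarith
  have hC : ∀ i, |τ (i + 1) - τ i - P (i + 1)| ≤ qC i := by
    intro i
    have := hP0 (i + 1)
    rcases lt_trichotomy i n with h | h | h
    · have := hPl i h
      simp only [hτ, hqC, h, h.le, Nat.succ_le_of_lt h, if_true]
      rw [abs_le]; constructor <;> linarith
    · subst h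
      simp only [hτ, hqC, le_refl, lt_irrefl, if_true, if_false]
      rw [if_neg (by omega), abs_le]; constructor <;> linarith
    · have := hPr i h
      simp only [hτ, hqC]
      rw [if_neg (by omega), if_neg (by omega), if_neg (by omega), if_neg (by omega), abs_le]
      constructor <;> linarith
  have hcA' : ∀ i, CA (i + 1) ≤ cA i := by
    intro i
    simp only [hcA]; split_ifs with h
    · exact hCAl i h
    · exact hCAr i (by omega)
  have hcC' : ∀ i, CC (i + 1) ≤ cC (i + 1) := by
    intro i
    simp only [hcC]; split_ifs with h h'
    · exact hCCl i h
    · rw [h']; exact hCCn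
    · exact hCCr _ (by omega)
  have hrow : ∀ i ∈ range N,
      s * ((τ i - τ (i + 1) - P (i + 1)) * x (i + 1)
          + (τ (i + 2) - τ (i + 1) - P (i + 2)) * y (i + 1))
        + α * CA (i + 1) * V i ^ 2 + β * CC (i + 1) * V (i + 2) ^ 2
      ≤ s * ((α * pA i + β * qC (i + 1)) / 2) * U (i + 1) ^ 2
        + (s * (α * pA i / 2) + α * cA i) * V i ^ 2
        + (s * (β * qC (i + 1) / 2) + β * cC (i + 1)) * V (i + 2) ^ 2 := by
    intro i hi
    have hi := mem_range.1 hi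
    have h1 := abs_cross_le (hA i) (hx i hi.le) hα
    have h2 := abs_cross_le (hC (i + 1)) (hy (i + 1) hi) hβ
    have h3 := mul_le_mul_of_nonneg_left h1 hs
    have h4 := mul_le_mul_of_nonneg_left h2 hs
    have h5 := mul_le_mul_of_nonneg_right (mul_le_mul_of_nonneg_left (hcA' i) hα) (sq_nonneg (V i))
    have h6 := mul_le_mul_of_nonneg_right (mul_le_mul_of_nonneg_left (hcC' i) hβ)
      (sq_nonneg (V (i + 2)))
    linarith
  have hdown := sum_shift_down N (fun i => s * (α * pA i / 2) + α * cA i) V hV0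
    fun i => by have := pA0 i; have := cA0 i; positivity
  have hup := sum_shift_up N (fun i => s * (β * qC i / 2) + β * cC i) V hVN
    fun i => by have := qC0 i; have := cC0 i; positivity
  have hUc : ∀ i, s ^ 2 * τ (i + 1) + s * ((α * pA i + β * qC (i + 1)) / 2) ≤ s * Ub := by
    intro i
    have : s * τ (i + 1) + (α * pA i + β * qC (i + 1)) / 2 ≤ Ub := by
      have b1 : β * f ≤ β * ω := mul_le_mul_of_nonneg_left hfω hβ
      have b2 : 0 ≤ β * e := mul_nonneg hβ he
      have b3 : α * Y + β * Y = Y := by rw [← add_mul, hαβ, one_mul]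
      have b4 : α * ω + β * ω = ω := by rw [← add_mul, hαβ, one_mul]
      simp only [hτ, hpA, hqC]
      split_ifs <;> first | omega | linarith
    linarith [mul_le_mul_of_nonneg_left this hs]
  have hVc : ∀ i < N, s * (α * pA (i + 1) / 2) + α * cA (i + 1) + (s * (β * qC i / 2) + β * cC i)
      + s * Ub ≤ s ^ 2 * τ (i + 1) + (2 * s * M + M ^ 2) * Φ (i + 1) := by
    intro i hi
    have hS := hΦ i hi
    have h0 : (2 * s * M + M ^ 2) * S ≤ (2 * s * M + M ^ 2) * Φ (i + 1) :=
      mul_le_mul_of_nonneg_left hS (by positivity)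
    have h1 : s * (Ub + Vb) ≤ s * (2 * M * S) := mul_le_mul_of_nonneg_left hUV hs
    have b1 : β * f ≤ β * ω := mul_le_mul_of_nonneg_left hfω hβ
    have b2 : 0 ≤ β * e := mul_nonneg hβ he
    have b3 : α = 1 - β := by linarith
    have c1 : s * (β * f) ≤ s * (β * ω) := mul_le_mul_of_nonneg_left b1 hs
    have c2 : s * ((Y + ω) / 2) ≤ s * Vb := mul_le_mul_of_nonneg_left hV1 hs
    have c3 : 0 ≤ s ^ 2 * e := by positivity
    suffices h : s * (α * pA (i + 1) / 2) + α * cA (i + 1) + (s * (β * qC i / 2) + β * cC i)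
        ≤ s ^ 2 * τ (i + 1) + s * Vb + M ^ 2 * S by linarith
    subst b3
    simp only [hτ, hpA, hqC, hcA, hcC]
    split_ifs <;> first | omega | linarith
  have hfin : ∑ i ∈ range N, ((s ^ 2 * τ (i + 1) + s * ((α * pA i + β * qC (i + 1)) / 2))
        * U (i + 1) ^ 2 + (s * (α * pA (i + 1) / 2) + α * cA (i + 1)
          + (s * (β * qC i / 2) + β * cC i)) * V (i + 1) ^ 2)
      ≤ ∑ i ∈ range N, (Ub * (s * (U (i + 1) ^ 2 - V (i + 1) ^ 2))
        + (s ^ 2 * τ (i + 1) + (2 * s * M + M ^ 2) * Φ (i + 1)) * V (i + 1) ^ 2) := by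
    refine sum_le_sum fun i hi => ?_
    have h1 := mul_le_mul_of_nonneg_right (hUc i) (sq_nonneg (U (i + 1)))
    have h2 := mul_le_mul_of_nonneg_right (hVc i (mem_range.1 hi)) (sq_nonneg (V (i + 1)))
    linarith
  have hrows := sum_le_sum hrow
  simp only [sum_add_distrib] at hrows hfin hdown hup
  rw [← mul_sum, bal, mul_zero, zero_add] at hfin
  have e1 : ∑ i ∈ range N, (s ^ 2 * (Φ (i + 1) * U (i + 1) ^ 2)
        + s * ((Φ i - Φ (i + 1) - P (i + 1)) * x (i + 1)
          + (Φ (i + 2) - Φ (i + 1) - P (i + 2)) * y (i + 1))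
        + α * CA (i + 1) * V i ^ 2 + β * CC (i + 1) * V (i + 2) ^ 2)
      = ∑ i ∈ range N, (s * ((τ i - τ (i + 1) - P (i + 1)) * x (i + 1)
          + (τ (i + 2) - τ (i + 1) - P (i + 2)) * y (i + 1))
        + α * CA (i + 1) * V i ^ 2 + β * CC (i + 1) * V (i + 2) ^ 2
        + (s ^ 2 * τ (i + 1) * U (i + 1) ^ 2
          + (s ^ 2 * Φ (i + 1) - s ^ 2 * τ (i + 1)) * V (i + 1) ^ 2)) := by
    have : ∀ a b : ℕ → ℝ, ∑ i ∈ range N, (a i - b i) = 0 → ∑ i ∈ range N, a i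
        = ∑ i ∈ range N, b i := fun a b h => by rw [sum_sub_distrib] at h; linarith
    apply this
    have k2 : ∑ i ∈ range N, (s * ((Φ (i + 1) - τ (i + 1)) * (s * (U (i + 1) ^ 2 - V (i + 1) ^ 2)))
        - s * ((Φ (i + 1) - τ (i + 1) - (Φ i - τ i)) * x (i + 1)
          + (Φ (i + 1) - τ (i + 1) - (Φ (i + 2) - τ (i + 2))) * y (i + 1))) = 0 := by
      rw [sum_sub_distrib, ← mul_sum, ← mul_sum, key, sub_self]
    rw [← k2]
    exact sum_congr rfl fun i _ => by ring
  rw [e1, mul_sum]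
  have e2 : ∑ i ∈ range N, (s + M) ^ 2 * (Φ (i + 1) * V (i + 1) ^ 2)
      = ∑ i ∈ range N, ((s ^ 2 * τ (i + 1) + (2 * s * M + M ^ 2) * Φ (i + 1)) * V (i + 1) ^ 2
        + (s ^ 2 * Φ (i + 1) - s ^ 2 * τ (i + 1)) * V (i + 1) ^ 2) :=
    sum_congr rfl fun i _ => by ring
  rw [e2]
  simp only [add_mul, sum_add_distrib] at hrows hfin hdown hup ⊢
  linarith

/-- An upper bound for the squared norm of the `(i + 1)`-st block row of `F (φ v)`, where `s` is the
smallest singular value of `F`, with singular vectors `u`, `v` of block norms `U`, `V`, and `x`, `y`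
are the inner products of the blocks of `u` with the off-diagonal blocks applied to `v`. -/
def rowFunctional (s α β : ℝ) (U V x y φ : ℕ → ℝ) (i : ℕ) : ℝ :=
  s ^ 2 * φ (i + 1) ^ 2 * U (i + 1) ^ 2
    + 2 * s * φ (i + 1) * ((φ i - φ (i + 1)) * x (i + 1) + (φ (i + 2) - φ (i + 1)) * y (i + 1))
    + (α * |φ i - φ (i + 1)| * V i + β * |φ (i + 2) - φ (i + 1)| * V (i + 2)) ^ 2

theorem rowFunctional_nonneg {s α β : ℝ} (hs : 0 ≤ s) {U V x y : ℕ → ℝ} {i : ℕ}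
    (hx : |x (i + 1)| ≤ α * (U (i + 1) * V i))
    (hy : |y (i + 1)| ≤ β * (U (i + 1) * V (i + 2))) (φ : ℕ → ℝ) :
    0 ≤ rowFunctional s α β U V x y φ i := by
  unfold rowFunctional
  set d := φ i - φ (i + 1)
  set d' := φ (i + 2) - φ (i + 1)
  have h1 : |φ (i + 1) * d * x (i + 1)| ≤ |φ (i + 1)| * |d| * (α * (U (i + 1) * V i)) := by
    rw [abs_mul, abs_mul]; gcongr
  have h2 : |φ (i + 1) * d' * y (i + 1)| ≤ |φ (i + 1)| * |d'| * (β * (U (i + 1) * V (i + 2))) := by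
    rw [abs_mul, abs_mul]; gcongr
  have h3 := mul_le_mul_of_nonneg_left (abs_le.1 h1).1 hs
  have h4 := mul_le_mul_of_nonneg_left (abs_le.1 h2).1 hs
  have h5 := sq_nonneg (s * |φ (i + 1)| * U (i + 1) - (α * |d| * V i + β * |d'| * V (i + 2)))
  have h6 : (s * |φ (i + 1)| * U (i + 1)) ^ 2 = s ^ 2 * φ (i + 1) ^ 2 * U (i + 1) ^ 2 := by
    rw [mul_pow, mul_pow, sq_abs]
  rw [sub_sq, h6] at h5
  linarith

/-- Partial sums `∑_{1 ≤ l ≤ j} F l`. -/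
def psum (F : ℕ → ℝ) (j : ℕ) : ℝ := ∑ l ∈ range j, F (l + 1)

theorem psum_succ (F : ℕ → ℝ) (j : ℕ) : psum F (j + 1) = psum F j + F (j + 1) :=
  sum_range_succ _ _

theorem psum_mono {F : ℕ → ℝ} (hF : ∀ j, 0 ≤ F j) : Monotone (psum F) :=
  monotone_nat_of_le_succ fun j => by rw [psum_succ]; linarith [hF (j + 1)]

theorem psum_nonneg {F : ℕ → ℝ} (hF : ∀ j, 0 ≤ F j) (j : ℕ) : 0 ≤ psum F j :=
  sum_nonneg fun _ _ => hF _

theorem psum_eq_of_le {F : ℕ → ℝ} {n : ℕ} (hF : ∀ j, n < j → F j = 0) {j : ℕ} (h : n ≤ j) :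
    psum F j = psum F n := by
  induction j, h using Nat.le_induction with
  | base => rfl
  | succ j h ih => rw [psum_succ, ih, hF _ (by omega), add_zero]

theorem psum_le_of_le {F : ℕ → ℝ} (hF0 : ∀ j, 0 ≤ F j) {n : ℕ} (hF : ∀ j, n < j → F j = 0)
    (j : ℕ) : psum F j ≤ psum F n := by
  rcases le_total j n with h | h
  · exact psum_mono hF0 h
  · exact (psum_eq_of_le hF h).le

/-- Shifted copies of `F`, closed off by a partial sum, add up to a partial sum. -/
theorem sum_shift_add_psum {F : ℕ → ℝ} (hF : F 0 = 0) (i K : ℕ) :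
    ∑ k ∈ range K, F (i - k) + psum F (i - K) = psum F i := by
  induction K with
  | zero => simp
  | succ K ih =>
    rw [sum_range_succ, ← ih]
    rcases Nat.lt_or_ge K i with h | h
    · obtain ⟨p, hp⟩ : ∃ p, i - K = p + 1 := ⟨i - K - 1, by omega⟩
      have : i - (K + 1) = p := by omega
      rw [this, hp, psum_succ]; ring
    · have h1 : i - K = 0 := by omega
      have h2 : i - (K + 1) = 0 := by omega
      rw [h1, h2, hF]; ring

/-- Reverse triangle inequality for square roots of sums of squares. -/
theorem sq_sqrt_sub_sqrt_le {ι : Type*} (t : Finset ι) (p q : ι → ℝ) :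
    (√(∑ l ∈ t, p l ^ 2) - √(∑ l ∈ t, q l ^ 2)) ^ 2 ≤ ∑ l ∈ t, (p l - q l) ^ 2 := by
  have hp : 0 ≤ ∑ l ∈ t, p l ^ 2 := sum_nonneg fun _ _ => sq_nonneg _
  have hq : 0 ≤ ∑ l ∈ t, q l ^ 2 := sum_nonneg fun _ _ => sq_nonneg _
  have h := Real.sum_mul_le_sqrt_mul_sqrt t p q
  have e : ∑ l ∈ t, (p l - q l) ^ 2
      = ∑ l ∈ t, p l ^ 2 + ∑ l ∈ t, q l ^ 2 - 2 * ∑ l ∈ t, p l * q l := by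
    rw [mul_sum, ← sum_add_distrib, ← sum_sub_distrib]
    exact sum_congr rfl fun _ _ => by ring
  rw [e, sub_sq, Real.sq_sqrt hp, Real.sq_sqrt hq]
  linarith

theorem sq_sqrt_psum_sub_le {w : ℕ → ℝ} (hw : w 0 = 0) (j : ℕ) :
    (√(psum (fun l => w l ^ 2) j) - √(psum (fun l => w l ^ 2) (j + 1))) ^ 2
      ≤ psum (fun l => (w l - w (l - 1)) ^ 2) (j + 1) := by
  have h := sq_sqrt_sub_sqrt_le (range (j + 1)) (fun l => w l) (fun l => w (l + 1))
  have e : ∑ l ∈ range (j + 1), w l ^ 2 = psum (fun l => w l ^ 2) j := by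
    rw [sum_range_succ', hw]; simp [psum]
  rw [e] at h
  refine h.trans (le_of_eq ?_)
  unfold psum
  exact sum_congr rfl fun l _ => by simp only [Nat.add_sub_cancel]; ring

theorem sq_convex_le {α β a b : ℝ} (hα : 0 ≤ α) (hβ : 0 ≤ β) (h : α + β = 1) :
    (α * a + β * b) ^ 2 ≤ α * a ^ 2 + β * b ^ 2 := by
  obtain rfl : α = 1 - β := by linarith
  nlinarith [mul_nonneg (mul_nonneg hα hβ) (sq_nonneg (a - b))]

/-- The cut-offs whose windows start after the first block: translates of the weights `w`, and a
final one that absorbs all the remaining translates. -/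
noncomputable def tailCut (w : ℕ → ℝ) (K k i : ℕ) : ℝ :=
  if k < K then w (i - (k + 1)) else √(psum (fun l => w l ^ 2) (i - (K + 1)))

/-- The squared increments of `w`. -/
def sqIncr (w : ℕ → ℝ) (l : ℕ) : ℝ := (w l - w (l - 1)) ^ 2

theorem sqIncr_nonneg (w : ℕ → ℝ) (l : ℕ) : 0 ≤ sqIncr w l := sq_nonneg _

theorem tailCut_sq_sum {w : ℕ → ℝ} (hw : w 0 = 0) (K i : ℕ) :
    ∑ k ∈ range (K + 1), tailCut w K k (i + 1) ^ 2 = psum (fun l => w l ^ 2) i := by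
  rw [sum_range_succ, ← sum_shift_add_psum (F := fun l => w l ^ 2) (by simp [hw]) i K]
  congr 1
  · refine sum_congr rfl fun k hk => ?_
    rw [tailCut, if_pos (mem_range.1 hk), Nat.add_sub_add_right]
  · rw [tailCut, if_neg (lt_irrefl K), Nat.add_sub_add_right,
      Real.sq_sqrt (psum_nonneg (fun _ => sq_nonneg _) _)]

theorem tailCut_link {w : ℕ → ℝ} {K k : ℕ} (hk : k < K) (i : ℕ) :
    (tailCut w K k i - tailCut w K k (i + 1)) ^ 2 = sqIncr w (i - k) := by
  rw [tailCut, tailCut, if_pos hk, if_pos hk, Nat.add_sub_add_right, sqIncr,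
    show i - (k + 1) = i - k - 1 by omega]
  ring

theorem tailCut_link_last {w : ℕ → ℝ} (hw : w 0 = 0) (K i : ℕ) :
    (tailCut w K K i - tailCut w K K (i + 1)) ^ 2 ≤ psum (sqIncr w) (i - K) := by
  rw [tailCut, tailCut, if_neg (lt_irrefl K), if_neg (lt_irrefl K), Nat.add_sub_add_right]
  rcases Nat.lt_or_ge K i with h | h
  · obtain ⟨p, hp⟩ : ∃ p, i - K = p + 1 := ⟨i - K - 1, by omega⟩
    rw [show i - (K + 1) = p by omega, hp]
    exact sq_sqrt_psum_sub_le hw p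
  · rw [show i - (K + 1) = 0 by omega, show i - K = 0 by omega]
    simp [psum]

theorem tailCut_link_sum_le {w : ℕ → ℝ} (hw : w 0 = 0) (K i : ℕ) :
    ∑ k ∈ range (K + 1), (tailCut w K k i - tailCut w K k (i + 1)) ^ 2 ≤ psum (sqIncr w) i := by
  rw [sum_range_succ, ← sum_shift_add_psum (F := sqIncr w) (by simp [sqIncr]) i K]
  exact add_le_add (sum_le_sum fun k hk => (tailCut_link (mem_range.1 hk) i).le)
    (tailCut_link_last hw K i)

theorem tailCut_link_sum_inside_le {w : ℕ → ℝ} (hw : w 0 = 0) (K n i : ℕ) :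
    ∑ k ∈ range (K + 1), (if i ≤ k + n then (tailCut w K k i - tailCut w K k (i + 1)) ^ 2 else 0)
      ≤ psum (sqIncr w) n := by
  set F : ℕ → ℝ := fun l => if l ≤ n then sqIncr w l else 0 with hF
  have hF0 : ∀ l, 0 ≤ F l := fun l => by
    simp only [hF]; split_ifs <;> [exact sqIncr_nonneg w l; exact le_rfl]
  have hFn : ∀ j ≤ n, psum F j = psum (sqIncr w) j := fun j hj => by
    refine sum_congr rfl fun l hl => ?_
    rw [mem_range] at hl
    simp only [hF]; rw [if_pos (by omega)]
  rw [← hFn n le_rfl]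
  refine le_trans ?_ (psum_le_of_le hF0 (n := n) (fun j hj => if_neg (by omega)) i)
  rw [sum_range_succ, ← sum_shift_add_psum (F := F) (by simp [hF, sqIncr]) i K]
  refine add_le_add (sum_le_sum fun k hk => ?_) ?_
  · rw [tailCut_link (mem_range.1 hk)]
    simp only [hF]
    split_ifs <;> first | omega | exact le_rfl
  · split_ifs with h
    · rw [hFn _ (by omega)]; exact tailCut_link_last hw K i
    · exact psum_nonneg hF0 _

/-- Averaging: if the weighted sum of an inequality over a family holds, some nontrivial member
satisfies it. -/
theorem exists_le_of_sum_le {ι : Type*} (t : Finset ι) (a b : ι → ℝ) {c : ℝ}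
    (ha : ∀ k ∈ t, 0 ≤ a k) (hb : ∀ k ∈ t, 0 ≤ b k) (hpos : 0 < ∑ k ∈ t, b k)
    (h : ∑ k ∈ t, a k ≤ c * ∑ k ∈ t, b k) : ∃ k ∈ t, 0 < b k ∧ a k ≤ c * b k := by
  by_contra! hcon
  obtain ⟨k, hk, hbk⟩ : ∃ k ∈ t, 0 < b k := by
    by_contra! h'
    exact absurd (sum_nonpos h') (not_le.2 hpos)
  refine absurd h (not_le.2 ?_)
  rw [mul_sum]
  refine sum_lt_sum (fun j hj => ?_) ⟨k, hk, hcon k hk hbk⟩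
  rcases (hb j hj).eq_or_lt with h0 | h0
  · rw [← h0, mul_zero]; exact ha j hj
  · exact (hcon j hj h0).le

/-- Expansion of the cross terms and convexity for the commutator. -/
theorem rowFunctional_le {s α β : ℝ} (hα : 0 ≤ α) (hβ : 0 ≤ β) (hαβ : α + β = 1)
    (U V x y φ : ℕ → ℝ) (i : ℕ) :
    rowFunctional s α β U V x y φ i
      ≤ s ^ 2 * (φ (i + 1) ^ 2 * U (i + 1) ^ 2)
        + s * ((φ i ^ 2 - φ (i + 1) ^ 2 - (φ i - φ (i + 1)) ^ 2) * x (i + 1)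
          + (φ (i + 2) ^ 2 - φ (i + 1) ^ 2 - (φ (i + 1) - φ (i + 2)) ^ 2) * y (i + 1))
        + α * (φ i - φ (i + 1)) ^ 2 * V i ^ 2
        + β * (φ (i + 1) - φ (i + 2)) ^ 2 * V (i + 2) ^ 2 := by
  have h := sq_convex_le (a := |φ i - φ (i + 1)| * V i) (b := |φ (i + 2) - φ (i + 1)| * V (i + 2))
    hα hβ hαβ
  rw [mul_pow, mul_pow, sq_abs, sq_abs] at h
  unfold rowFunctional
  nlinarith

/-- Some cut-off supported in a window of length `n` satisfies the required row estimate. -/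
def HasGoodCutoff (N n : ℕ) (s α β M : ℝ) (U V x y : ℕ → ℝ) : Prop :=
  ∃ (k : ℕ) (φ : ℕ → ℝ), k + n ≤ N ∧
    (∀ i, 1 ≤ i → i ≤ N → φ i ≠ 0 → k < i ∧ i ≤ k + n) ∧
    0 < ∑ i ∈ range N, φ (i + 1) ^ 2 * V (i + 1) ^ 2 ∧
    ∑ i ∈ range N, (if k < i + 1 ∧ i + 1 ≤ k + n then rowFunctional s α β U V x y φ i else 0)
      ≤ (s + M) ^ 2 * ∑ i ∈ range N, φ (i + 1) ^ 2 * V (i + 1) ^ 2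

theorem tailCut_support {w : ℕ → ℝ} {n K k i : ℕ} (hw0 : w 0 = 0) (hwn : ∀ j, n < j → w j = 0)
    (hk : k ≤ K) (hi : i ≤ K + 1 + n) (h : tailCut w K k i ≠ 0) :
    k + 1 < i ∧ i ≤ k + 1 + n := by
  by_contra hcon
  apply h
  unfold tailCut
  split_ifs with hkK
  · rcases Nat.lt_or_ge (k + 1) i with h1 | h1
    · exact hwn _ (by omega)
    · rw [show i - (k + 1) = 0 by omega, hw0]
  · rw [show i - (K + 1) = 0 by omega]; simp [psum]

set_option maxHeartbeats 1000000 in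
theorem hasGoodCutoff_of_weights {K n : ℕ} {α β s M ω f e H Ub Vb : ℝ} {w φ₀ : ℕ → ℝ}
    (hα : 0 ≤ α) (hβ : 0 ≤ β) (hαβ : α + β = 1) (hs : 0 ≤ s) (hM : 0 ≤ M)
    (hw0 : w 0 = 0) (hwn : ∀ j, n < j → w j = 0) (hω : w n ^ 2 = ω) (hn : 1 ≤ n)
    (hf : 0 ≤ f) (he : 0 ≤ e) (hH : 0 ≤ H) (hfω : f ≤ ω)
    (hS : 0 < psum (fun l => w l ^ 2) n)
    (h0sq : ∀ i < n, psum (fun l => w l ^ 2) n - psum (fun l => w l ^ 2) i ≤ φ₀ (i + 1) ^ 2)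
    (h0link : ∀ i < n, (φ₀ i - φ₀ (i + 1)) ^ 2 ≤ psum (sqIncr w) n - psum (sqIncr w) i + f)
    (h0n : φ₀ n ^ 2 = ω + e) (h0z : ∀ i, n < i → φ₀ i = 0)
    (h0row : ∀ a b : ℝ, (α * |φ₀ (n - 1) - φ₀ n| * a + β * |φ₀ n| * b) ^ 2
      ≤ α * (φ₀ (n - 1) - φ₀ n) ^ 2 * a ^ 2 + β * H * b ^ 2)
    {U V x y : ℕ → ℝ}
    (hU0 : U 0 = 0) (hV0 : V 0 = 0) (hUN : U (K + 1 + n + 1) = 0) (hVN : V (K + 1 + n + 1) = 0)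
    (hVpos : 0 < ∑ i ∈ range (K + 1 + n), V (i + 1) ^ 2)
    (hx : ∀ i ≤ K + 1 + n, |x (i + 1)| ≤ α * (U (i + 1) * V i))
    (hy : ∀ i ≤ K + 1 + n, |y i| ≤ β * (U i * V (i + 1)))
    (hloc : ∀ i < K + 1 + n, s * (U (i + 1) ^ 2 - V (i + 1) ^ 2)
      = x (i + 1) + y (i + 1) - x (i + 2) - y i)
    (hU1 : (psum (sqIncr w) n + ω) / 2 ≤ Ub)
    (hU2 : s * e + β * e + (psum (sqIncr w) n + α * f + β * ω) / 2 ≤ Ub)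
    (hV1 : (psum (sqIncr w) n + ω) / 2 ≤ Vb)
    (hV2 : s * ((psum (sqIncr w) n + f) / 2) + psum (sqIncr w) n + f
      ≤ s * Vb + s ^ 2 * e + M ^ 2 * psum (fun l => w l ^ 2) n)
    (hV3 : s * ((psum (sqIncr w) n + ω) / 2 + β * e) + psum (sqIncr w) n + β * H
      ≤ s * Vb + M ^ 2 * psum (fun l => w l ^ 2) n)
    (hYS : psum (sqIncr w) n + β * ω ≤ M ^ 2 * psum (fun l => w l ^ 2) n)
    (hUV : Ub + Vb ≤ 2 * M * psum (fun l => w l ^ 2) n) :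
    HasGoodCutoff (K + 1 + n) n s α β M U V x y := by
  set N := K + 1 + n with hN
  set Y := psum (sqIncr w) n with hY
  set S := psum (fun l => w l ^ 2) n with hSdef
  have hY0 : 0 ≤ Y := psum_nonneg (sqIncr_nonneg w) n
  have hω0 : 0 ≤ ω := hω ▸ sq_nonneg _
  have hDmono : ∀ i ≤ n, psum (sqIncr w) i ≤ Y := fun i hi => psum_mono (sqIncr_nonneg w) hi
  have hDn1 : psum (sqIncr w) (n + 1) = Y + ω := by
    rw [psum_succ, sqIncr, hwn (n + 1) (by omega), Nat.add_sub_cancel, zero_sub, neg_sq, hω]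
  have hDle : ∀ i, psum (sqIncr w) i ≤ Y + ω := fun i => by
    rw [← hDn1]
    refine psum_le_of_le (sqIncr_nonneg w) (fun j hj => ?_) i
    rw [sqIncr, hwn j (by omega), hwn (j - 1) (by omega)]; simp
  set tc : ℕ → ℕ → ℝ := tailCut w K with htc
  set Φ : ℕ → ℝ := fun i => φ₀ i ^ 2 + ∑ k ∈ range (K + 1), tc k i ^ 2 with hΦ
  set P : ℕ → ℝ := fun i => (φ₀ (i - 1) - φ₀ i) ^ 2
    + ∑ k ∈ range (K + 1), (tc k (i - 1) - tc k i) ^ 2 with hP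
  set CA : ℕ → ℝ := fun i => (if i ≤ n then (φ₀ (i - 1) - φ₀ i) ^ 2 else 0)
    + ∑ k ∈ range (K + 1), (if i - 1 ≤ k + n then (tc k (i - 1) - tc k i) ^ 2 else 0) with hCA
  set CC : ℕ → ℝ := fun i => (if i < n then (φ₀ i - φ₀ (i + 1)) ^ 2 else if i = n then H else 0)
    + ∑ k ∈ range (K + 1), (tc k i - tc k (i + 1)) ^ 2 with hCC
  have hPs : ∀ i, ∑ k ∈ range (K + 1), (tc k i - tc k (i + 1)) ^ 2 ≤ psum (sqIncr w) i :=
    tailCut_link_sum_le hw0 K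
  have hPs0 : ∀ i, 0 ≤ ∑ k ∈ range (K + 1), (tc k i - tc k (i + 1)) ^ 2 :=
    fun i => sum_nonneg fun _ _ => sq_nonneg _
  have hΦS : ∀ i < N, S ≤ Φ (i + 1) := by
    intro i hi
    simp only [hΦ, htc, tailCut_sq_sum hw0]
    rcases Nat.lt_or_ge i n with h | h
    · linarith [h0sq i h]
    · rw [psum_eq_of_le (fun j hj => by rw [hwn j hj]; simp) h]
      linarith [sq_nonneg (φ₀ (i + 1))]
  have agg := sum_row_le_of_aggregates (N := N) (n := n) (S := S) (Y := Y) (ω := ω) (f := f)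
      (e := e)
    (H := H) (Ub := Ub) (Vb := Vb) (Φ := Φ) (P := P) (CA := CA) (CC := CC) hα hβ hαβ hs hM hY0 hω0
    hf he hH hfω hU0 hV0 hUN hVN hx hy hloc hΦS
    (fun i => add_nonneg (sq_nonneg _) (sum_nonneg fun _ _ => sq_nonneg _))
    (fun i hi => by
      simp only [hP, Nat.add_sub_cancel]
      linarith [hPs i, h0link i hi])
    (by
      simp only [hP, Nat.add_sub_cancel, h0z (n + 1) (by omega), sub_zero, h0n]
      linarith [hPs0 n])
    (by
      simp only [hP, Nat.add_sub_cancel, h0z (n + 1) (by omega), sub_zero, h0n]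
      linarith [hPs n])
    (fun i hi => by
      simp only [hP, Nat.add_sub_cancel, h0z (i + 1) (by omega), h0z i hi]
      linarith [hPs i, hDle i])
    (fun i hi => by
      simp only [hCA, Nat.add_sub_cancel]
      rw [if_pos (by omega)]
      have : ∑ k ∈ range (K + 1), (if i ≤ k + n then (tc k i - tc k (i + 1)) ^ 2 else 0)
          ≤ ∑ k ∈ range (K + 1), (tc k i - tc k (i + 1)) ^ 2 :=
        sum_le_sum fun k _ => by split_ifs <;> [exact le_rfl; exact sq_nonneg _]
      linarith [hPs i, h0link i hi])
    (fun i hi => by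
      simp only [hCA, Nat.add_sub_cancel]
      rw [if_neg (by omega), zero_add]
      exact tailCut_link_sum_inside_le hw0 K n i)
    (fun i hi => by
      simp only [hCC]
      rw [if_pos hi]
      linarith [hPs (i + 1), h0link (i + 1) hi])
    (by
      simp only [hCC, lt_irrefl, if_true, if_false]
      linarith [hPs n])
    (fun i hi => by
      simp only [hCC]
      rw [if_neg (by omega), if_neg (by omega)]
      linarith [hPs i, hDle i])
    hU1 hU2 hV1 hV2 hV3 hYS hUV
  have hR0 : ∀ φ : ℕ → ℝ, ∀ i < N, 0 ≤ rowFunctional s α β U V x y φ i :=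
    fun φ i hi => rowFunctional_nonneg hs (hx i hi.le) (hy (i + 1) hi) φ
  have row0 : ∀ i < N, (if i + 1 ≤ n then rowFunctional s α β U V x y φ₀ i else 0)
      ≤ s ^ 2 * (φ₀ (i + 1) ^ 2 * U (i + 1) ^ 2)
        + s * ((φ₀ i ^ 2 - φ₀ (i + 1) ^ 2 - (φ₀ i - φ₀ (i + 1)) ^ 2) * x (i + 1)
          + (φ₀ (i + 2) ^ 2 - φ₀ (i + 1) ^ 2 - (φ₀ (i + 1) - φ₀ (i + 2)) ^ 2) * y (i + 1))
        + α * (if i + 1 ≤ n then (φ₀ i - φ₀ (i + 1)) ^ 2 else 0) * V i ^ 2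
        + β * (if i + 1 < n then (φ₀ (i + 1) - φ₀ (i + 2)) ^ 2 else if i + 1 = n then H else 0)
          * V (i + 2) ^ 2 := by
    intro i _
    rcases lt_trichotomy (i + 1) n with h | h | h
    · rw [if_pos h.le, if_pos h.le, if_pos h]
      exact rowFunctional_le hα hβ hαβ U V x y φ₀ i
    · subst h
      have hr := h0row (V i) (V (i + 2))
      simp only [le_refl, lt_irrefl, if_true, if_false]
      simp only [Nat.add_sub_cancel] at hr
      unfold rowFunctional
      rw [h0z (i + 2) (by omega), zero_sub, abs_neg]
      linarith
    · rw [if_neg (by omega), if_neg (by omega), if_neg (by omega), if_neg (by omega),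
        h0z (i + 1) h, h0z (i + 2) (by omega)]
      apply le_of_eq; ring
  have rowt : ∀ k ≤ K, ∀ i < N, (if i ≤ k + n then rowFunctional s α β U V x y (tc k) i else 0)
      ≤ s ^ 2 * (tc k (i + 1) ^ 2 * U (i + 1) ^ 2)
        + s * ((tc k i ^ 2 - tc k (i + 1) ^ 2 - (tc k i - tc k (i + 1)) ^ 2) * x (i + 1)
          + (tc k (i + 2) ^ 2 - tc k (i + 1) ^ 2 - (tc k (i + 1) - tc k (i + 2)) ^ 2) * y (i + 1))
        + α * (if i ≤ k + n then (tc k i - tc k (i + 1)) ^ 2 else 0) * V i ^ 2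
        + β * (tc k (i + 1) - tc k (i + 2)) ^ 2 * V (i + 2) ^ 2 := by
    intro k hk i hi
    split_ifs with h
    · exact rowFunctional_le hα hβ hαβ U V x y (tc k) i
    · have : tc k (i + 1) = 0 := by
        by_contra h'
        have := tailCut_support hw0 hwn hk (by omega : i + 1 ≤ K + 1 + n) h'
        omega
      rw [this]
      have : 0 ≤ β * (0 - tc k (i + 2)) ^ 2 * V (i + 2) ^ 2 := by positivity
      linarith
  set c : ℕ → ℕ → ℝ := fun k => Nat.casesOn k φ₀ tc with hc
  have total : ∑ k ∈ range (K + 2), ∑ i ∈ range N,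
      (if i + 1 ≤ k + n then rowFunctional s α β U V x y (c k) i else 0)
      ≤ (s + M) ^ 2 * ∑ k ∈ range (K + 2), ∑ i ∈ range N, c k (i + 1) ^ 2 * V (i + 1) ^ 2 := by
    rw [sum_comm, sum_comm (s := range (K + 2))]
    have e1 : ∀ i, ∑ k ∈ range (K + 2), c k (i + 1) ^ 2 * V (i + 1) ^ 2
        = Φ (i + 1) * V (i + 1) ^ 2 := fun i => by
      rw [← sum_mul, sum_range_succ', add_comm]; rfl
    simp only [e1]
    refine le_trans (sum_le_sum fun i hi => ?_) agg
    rw [sum_range_succ']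
    have h1 := row0 i (mem_range.1 hi)
    have h2 := sum_le_sum fun k (hk : k ∈ range (K + 1)) =>
      rowt k (by rw [mem_range] at hk; omega) i (mem_range.1 hi)
    have e2 : ∀ k, (i + 1 ≤ k + 1 + n) = (i ≤ k + n) := fun k => by
      apply propext; omega
    simp only [e2, zero_add]
    refine (add_le_add h2 h1).trans (le_of_eq ?_)
    simp only [hΦ, hP, hCA, hCC, Nat.add_sub_cancel, sum_add_distrib, ← mul_sum, ← sum_mul,
      sum_sub_distrib, show i + 2 - 1 = i + 1 from rfl, add_assoc, Nat.reduceAdd]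
    ring
  obtain ⟨k, hk, hpos, hle⟩ := exists_le_of_sum_le (range (K + 2)) _ _
    (fun k _ => sum_nonneg fun i hi => by
      split_ifs <;> [exact hR0 _ i (mem_range.1 hi); exact le_rfl])
    (fun k _ => sum_nonneg fun i _ => by positivity) (by
      rw [sum_comm]
      refine lt_of_lt_of_le (mul_pos hS hVpos) ?_
      rw [mul_sum]
      refine sum_le_sum fun i hi => ?_
      rw [← sum_mul, sum_range_succ']
      refine mul_le_mul_of_nonneg_right ((hΦS i (mem_range.1 hi)).trans (le_of_eq ?_))
        (sq_nonneg _)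
      exact add_comm _ _) total
  rw [mem_range] at hk
  refine ⟨k, c k, by omega, ?_, hpos, le_trans (sum_le_sum fun i hi => ?_) hle⟩
  · intro i hi1 hiN hne
    cases k with
    | zero =>
      refine ⟨by omega, ?_⟩
      by_contra h
      exact hne (h0z i (by omega))
    | succ k => exact tailCut_support hw0 hwn (by omega) hiN hne
  · have := hR0 (c k) i (mem_range.1 hi)
    split_ifs <;> first | omega | exact le_rfl

/-- The numerical conditions on the parameters of the first cut-off, in units of `w n ^ 2`. -/
structure IsAdmissibleParam (μ α β γ s g e H u v : ℝ) : Prop where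
  u_ge : 1 / 2 ≤ u
  u_ge' : s * e + β * e + (α * g + β) / 2 ≤ u
  v_ge : 1 / 2 ≤ v
  v_ge' : s * g / 2 + (g - γ - μ) ≤ s * v + s ^ 2 * e
  v_ge'' : s * (1 / 2 + β * e) + β * H ≤ s * v + γ + μ

theorem isAdmissibleParam_flat_large {μ γ s : ℝ} (hμ : 0 ≤ μ) (hs : 0 ≤ s) (hγ0 : 0 < γ)
    (hγ : γ ≤ 1 / 3)
    (hsγ : s * (1 - γ) ≤ γ) :
    IsAdmissibleParam μ (1 / (1 + γ)) (γ / (1 + γ)) γ s γ ((1 - γ) ^ 2 / (4 * γ) + (1 + γ) ^ 2)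
      (γ / (1 + γ) * (1 + ((1 - γ) ^ 2 / (4 * γ) + (1 + γ) ^ 2)))
      (3 / 4 + s / 4 + 4 * γ) (3 / 4 - s / 4 + 2 * γ) := by
  have hs2 : s ≤ 1 / 2 := by nlinarith
  have h1γ : 0 < 1 + γ := by linarith
  have hse : s * ((1 - γ) ^ 2 / (4 * γ)) ≤ (1 - γ) / 4 := by
    rw [mul_div_assoc', div_le_div_iff₀ (by positivity) (by norm_num)]
    nlinarith
  have hs1 : s * (1 + γ) ^ 2 ≤ s + γ * (s * (2 + γ)) := by nlinarith
  have hβe : γ / (1 + γ) * ((1 - γ) ^ 2 / (4 * γ) + (1 + γ) ^ 2)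
      = (1 - γ) ^ 2 / (4 * (1 + γ)) + γ * (1 + γ) := by field_simp
  have hβe' : (1 - γ) ^ 2 / (4 * (1 + γ)) ≤ 1 / 4 - γ / 2 := by
    rw [div_le_iff₀ (by positivity)]; nlinarith
  have hα : (1 / (1 + γ) * γ + γ / (1 + γ)) / 2 = γ / (1 + γ) := by field_simp; ring
  have hβ : γ / (1 + γ) ≤ γ := by rw [div_le_iff₀ h1γ]; nlinarith
  have hβ0 : 0 ≤ γ / (1 + γ) := by positivity
  refine ⟨by linarith, ?_, by linarith, ?_, ?_⟩
  · rw [hβe, hα]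
    nlinarith
  · have : 0 ≤ s ^ 2 * ((1 - γ) ^ 2 / (4 * γ) + (1 + γ) ^ 2) := by positivity
    nlinarith
  · rw [hβe, mul_add (γ / (1 + γ)) 1, hβe, mul_one]
    have h3 : γ / (1 + γ) * (γ / (1 + γ) + ((1 - γ) ^ 2 / (4 * (1 + γ)) + γ * (1 + γ))) ≤ γ := by
      have : γ / (1 + γ) + ((1 - γ) ^ 2 / (4 * (1 + γ)) + γ * (1 + γ)) ≤ 1 + γ := by nlinarith
      calc _ ≤ γ / (1 + γ) * (1 + γ) := mul_le_mul_of_nonneg_left this hβ0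
        _ = γ := by field_simp
    have h4 : (1 - γ) ^ 2 / (4 * (1 + γ)) + γ * (1 + γ) ≤ 1 / 4 - s / 4 + 2 * γ := by nlinarith
    nlinarith [mul_le_mul_of_nonneg_left h4 hs]

theorem isAdmissibleParam_sharp_large {μ γ s : ℝ} (hμ : 0 ≤ μ) (hs : 0 ≤ s) (hγ0 : 1 / 3 ≤ γ)
    (hγ : γ ≤ 1)
    (hsγ : s * (1 - γ) ≤ γ) :
    IsAdmissibleParam μ (1 / (1 + γ)) (γ / (1 + γ)) γ s γ ((1 - γ) ^ 2 / (4 * γ))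
      (1 + (1 - γ) ^ 2 / (4 * γ)) (2 / 3 + γ) (3 / 4 + γ) := by
  have h1γ : 0 < 1 + γ := by linarith
  have h2γ : 0 < γ := by linarith
  have hse : s * ((1 - γ) ^ 2 / (4 * γ)) ≤ (1 - γ) / 4 := by
    rw [mul_div_assoc', div_le_div_iff₀ (by positivity) (by norm_num)]
    nlinarith
  have hβe : γ / (1 + γ) * ((1 - γ) ^ 2 / (4 * γ)) = (1 - γ) ^ 2 / (4 * (1 + γ)) := by field_simp
  have hβe' : (1 - γ) ^ 2 / (4 * (1 + γ)) ≤ 1 / 4 - γ / 4 := by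
    rw [div_le_iff₀ (by positivity)]; nlinarith
  have hα : (1 / (1 + γ) * γ + γ / (1 + γ)) / 2 = γ / (1 + γ) := by field_simp; ring
  have hβ : γ / (1 + γ) ≤ 3 / 4 * γ := by rw [div_le_iff₀ h1γ]; nlinarith
  refine ⟨by linarith, ?_, by linarith, ?_, ?_⟩
  · rw [hβe, hα]
    have : (1 - γ) ^ 2 / (4 * (1 + γ)) + γ / (1 + γ) = (1 + γ) / 4 := by field_simp; ring
    linarith
  · have : 0 ≤ s ^ 2 * ((1 - γ) ^ 2 / (4 * γ)) := by positivity
    nlinarith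
  · rw [hβe, mul_add (γ / (1 + γ)) 1, hβe, mul_one]
    have : (1 - γ) ^ 2 / (4 * (1 + γ)) + γ / (1 + γ) = (1 + γ) / 4 := by field_simp; ring
    nlinarith [mul_le_mul_of_nonneg_left hβe' hs, mul_nonneg hs h2γ.le]

theorem isAdmissibleParam_flat_small {μ γ s : ℝ} (hμ : 0 ≤ μ) (hs : 0 < s) (hγ0 : 0 ≤ γ)
    (hs2 : s ≤ 1 / 2)
    (hsγ : γ ≤ s * (1 - γ)) :
    IsAdmissibleParam μ (1 / (1 + γ)) (γ / (1 + γ)) γ s (s / (1 + s))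
        (1 / (4 * s * (1 + s)) + (1 + γ) ^ 2)
      (γ / (1 + γ) * (1 + (1 / (4 * s * (1 + s)) + (1 + γ) ^ 2)))
      (3 / 4 + s / 4 + 4 * γ) (3 / 4 - s / 4 + 2 * γ) := by
  have h1γ : 0 < 1 + γ := by linarith
  have h1s : 0 < 1 + s := by linarith
  have hγ3 : γ ≤ 1 / 3 := by nlinarith
  have hse : s * (1 / (4 * s * (1 + s))) = 1 / (4 * (1 + s)) := by field_simp
  have hse' : 1 / (4 * (1 + s)) ≤ 1 / 4 - s / 6 := by
    rw [div_le_iff₀ (by positivity)]; nlinarith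
  have hβ1 : γ / (1 + γ) ≤ s / (1 + 2 * s) := by
    rw [div_le_div_iff₀ h1γ (by positivity)]; nlinarith
  have hβe : γ / (1 + γ) * (1 / (4 * s * (1 + s)) + (1 + γ) ^ 2)
      = γ / (1 + γ) * (1 / (4 * s * (1 + s))) + γ * (1 + γ) := by field_simp
  have hβe1 : γ / (1 + γ) * (1 / (4 * s * (1 + s))) ≤ 1 / 4 - s / 4 := by
    refine (mul_le_mul_of_nonneg_right hβ1 (by positivity)).trans ?_
    rw [div_mul_div_comm, div_le_iff₀ (by positivity)]
    nlinarith [mul_nonneg hs.le (sub_nonneg.2 hs2), mul_nonneg (mul_nonneg hs.le hs.le)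
        (sub_nonneg.2 hs2),
      mul_nonneg (mul_nonneg (mul_nonneg hs.le hs.le) hs.le) (sub_nonneg.2 hs2)]
  have hα : 1 / (1 + γ) * (s / (1 + s)) ≤ s / (1 + s) :=
    mul_le_of_le_one_left (by positivity) (by rw [div_le_one h1γ]; linarith)
  have hβ0 : 0 ≤ γ / (1 + γ) := by positivity
  have hβ : γ / (1 + γ) ≤ γ := by rw [div_le_iff₀ h1γ]; nlinarith
  have hg : s / (1 + s) ≤ s - s ^ 2 * (2 / 3) := by rw [div_le_iff₀ h1s]; nlinarith [mul_pos hs hs]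
  refine ⟨by linarith, ?_, by linarith, ?_, ?_⟩
  · rw [hβe, mul_add s, hse]
    set E := γ / (1 + γ) * (1 / (4 * s * (1 + s))) with hE
    rcases le_total s (1 / 4) with h | h
    · nlinarith
    · have hEγ : E ≤ γ := by
        have : 1 / (4 * s * (1 + s)) ≤ 1 := by rw [div_le_one (by positivity)]; nlinarith
        calc E ≤ γ * 1 := mul_le_mul hβ this (by positivity) hγ0
          _ = γ := mul_one γ
      nlinarith [mul_nonneg hγ0 (sub_nonneg.2 hs2), mul_nonneg hγ0 (sub_nonneg.2 hγ3),
        mul_nonneg (mul_nonneg hγ0 hs.le) (sub_nonneg.2 hγ3)]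
  · have e1 : s ^ 2 * (1 / (4 * s * (1 + s)) + (1 + γ) ^ 2)
        = s * (1 / (4 * (1 + s))) + s ^ 2 * (1 + γ) ^ 2 := by rw [← hse]; ring
    have e2 : s / (1 + s) = s * (1 / (1 + s)) := by ring
    have e3 : 1 / (4 * (1 + s)) = 1 / (1 + s) / 4 := by field_simp
    rw [e1, e2, e3]
    have hp : 1 / (1 + s) ≤ 1 := by rw [div_le_one h1s]; linarith
    set p := 1 / (1 + s)
    nlinarith [mul_le_mul_of_nonneg_left hp hs.le, mul_le_mul_of_nonneg_left hp (sq_nonneg s),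
      mul_nonneg hs.le hγ0, mul_nonneg (sq_nonneg s) hγ0, mul_nonneg (sq_nonneg s) (sq_nonneg γ)]
  · rw [hβe, mul_add (γ / (1 + γ)) 1, hβe, mul_one]
    have h3 : γ / (1 + γ) * (γ / (1 + γ) + (γ / (1 + γ) * (1 / (4 * s * (1 + s))) + γ * (1 + γ)))
        ≤ γ := by
      have : γ / (1 + γ) + (γ / (1 + γ) * (1 / (4 * s * (1 + s))) + γ * (1 + γ)) ≤ 1 + γ := by
        nlinarith
      calc _ ≤ γ / (1 + γ) * (1 + γ) := mul_le_mul_of_nonneg_left this hβ0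
        _ = γ := by field_simp
    nlinarith [mul_le_mul_of_nonneg_left hβe1 hs.le]

theorem isAdmissibleParam_sharp_small {μ γ s : ℝ} (hμ : 0 ≤ μ) (hs : 1 / 2 ≤ s) (hγ0 : 0 ≤ γ) :
    IsAdmissibleParam μ (1 / (1 + γ)) (γ / (1 + γ)) γ s (s / (1 + s)) (1 / (4 * s * (1 + s)))
      (1 + 1 / (4 * s * (1 + s))) (2 / 3 + γ) (3 / 4 + γ) := by
  have h1γ : 0 < 1 + γ := by linarith
  have h1s : 0 < 1 + s := by linarith
  have h0s : 0 < s := by linarith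
  have hse : s * (1 / (4 * s * (1 + s))) = 1 / (1 + s) / 4 := by field_simp
  have he : 1 / (4 * s * (1 + s)) ≤ 1 / 3 := by
    rw [div_le_div_iff₀ (by positivity) (by norm_num)]; nlinarith
  have hβ0 : 0 ≤ γ / (1 + γ) := by positivity
  have hβ : γ / (1 + γ) ≤ γ := by rw [div_le_iff₀ h1γ]; nlinarith
  have hα : 1 / (1 + γ) * (s / (1 + s)) ≤ s / (1 + s) :=
    mul_le_of_le_one_left (by positivity) (by rw [div_le_one h1γ]; linarith)
  have hβe : γ / (1 + γ) * (1 / (4 * s * (1 + s))) ≤ γ * (1 / 3) :=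
    mul_le_mul hβ he (by positivity) hγ0
  have e2 : s / (1 + s) = 1 - 1 / (1 + s) := by field_simp; ring
  have hp0 : 0 < 1 / (1 + s) := by positivity
  have hp : 1 / (1 + s) ≤ 1 := by rw [div_le_one h1s]; linarith
  have hp1 : s * (1 / (1 + s)) = 1 - 1 / (1 + s) := by field_simp; ring
  refine ⟨by linarith, ?_, by linarith, ?_, ?_⟩
  · rw [hse]; linarith
  · have e1 : s ^ 2 * (1 / (4 * s * (1 + s))) = s * (1 / (1 + s) / 4) := by rw [← hse]; ring
    rw [e1, e2]
    nlinarith [mul_nonneg h0s.le hγ0]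
  · nlinarith [mul_le_mul_of_nonneg_left hβe h0s.le, mul_nonneg h0s.le hγ0,
      mul_le_mul_of_nonneg_right hs hγ0]

/-- Admissible parameters for the first cut-off always exist. -/
theorem exists_isAdmissibleParam {μ γ s R : ℝ} (hμ : 0 < μ) (hs : 0 ≤ s) (hγ0 : 0 ≤ γ) (hγ : γ ≤ 1)
    (hR : 3 / 2 + 4 * γ ≤ R) (hR' : γ ≤ 1 / 3 → 3 / 2 + 6 * γ ≤ R) :
    ∃ g e₀ e H u v : ℝ, 0 < g ∧ g ≤ 1 ∧ e₀ = (1 - g) ^ 2 / (4 * g) ∧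
      ((e = e₀ ∧ H = 1 + e) ∨ (e = e₀ + (1 + γ) ^ 2 ∧ H = γ / (1 + γ) * (1 + e))) ∧
      IsAdmissibleParam μ (1 / (1 + γ)) (γ / (1 + γ)) γ s g e H u v ∧ u + v ≤ R := by
  rcases le_or_gt (s * (1 - γ)) γ with h | h
  · rcases hγ0.eq_or_lt with h0 | h0
    · subst h0
      obtain rfl : s = 0 := by linarith
      have hg : 0 < min μ (1 / 3) := lt_min hμ (by norm_num)
      have hg1 := min_le_left μ (1 / 3)
      have hg2 := min_le_right μ (1 / 3)
      refine ⟨min μ (1 / 3), _, _, _, 3 / 4, 3 / 4, hg, by linarith, rfl, Or.inl ⟨rfl, rfl⟩,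
        ⟨by norm_num, ?_, by norm_num, ?_, ?_⟩, by linarith⟩
      · simp only [zero_mul, add_zero, div_one, one_mul]; linarith
      · simp only [zero_mul, zero_div]; linarith
      · simp only [zero_mul, zero_div]; linarith
    · rcases le_or_gt γ (1 / 3) with h3 | h3
      · exact ⟨γ, _, _, _, _, _, h0, hγ, rfl, Or.inr ⟨rfl, rfl⟩,
          isAdmissibleParam_flat_large hμ.le hs h0 h3 h, by linarith [hR' h3]⟩
      · exact ⟨γ, _, _, _, _, _, h0, hγ, rfl, Or.inl ⟨rfl, rfl⟩,
          isAdmissibleParam_sharp_large hμ.le hs h3.le hγ h, by linarith⟩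
  · have h0 : 0 < s := by nlinarith
    have hg : 0 < s / (1 + s) := by positivity
    have hg1 : s / (1 + s) ≤ 1 := by rw [div_le_one (by positivity)]; linarith
    have he : 1 / (4 * s * (1 + s)) = (1 - s / (1 + s)) ^ 2 / (4 * (s / (1 + s))) := by
      field_simp; ring
    rcases le_or_gt s (1 / 2) with h3 | h3
    · exact ⟨s / (1 + s), _, _, _, _, _, hg, hg1, he, Or.inr ⟨rfl, rfl⟩,
          isAdmissibleParam_flat_small hμ.le h0 hγ0 h3 h.le, by linarith [hR' (by nlinarith)]⟩
    · exact ⟨s / (1 + s), _, _, _, _, _, hg, hg1, he, Or.inl ⟨rfl, rfl⟩,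
          isAdmissibleParam_sharp_small hμ.le h3.le hγ0, by linarith⟩

theorem psum_add (F : ℕ → ℝ) (j m : ℕ) :
    psum F (j + m) = psum F j + ∑ l ∈ range m, F (j + l + 1) := by
  simp only [psum, sum_range_add]

/-- The decreasing profile used for the first cut-off. -/
noncomputable def headProfile (w : ℕ → ℝ) (n : ℕ) (τ : ℝ) (i : ℕ) : ℝ :=
  √(psum (fun l => w l ^ 2) (n - 1) - psum (fun l => w l ^ 2) (i - 1) + τ ^ 2)

theorem headProfile_sq {w : ℕ → ℝ} {n i : ℕ} (τ : ℝ) (hi : i ≤ n) :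
    headProfile w n τ i ^ 2
      = psum (fun l => w l ^ 2) (n - 1) - psum (fun l => w l ^ 2) (i - 1) + τ ^ 2 := by
  refine Real.sq_sqrt ?_
  have := psum_mono (F := fun l => w l ^ 2) (fun l => sq_nonneg _) (show i - 1 ≤ n - 1 by omega)
  nlinarith [sq_nonneg τ]

theorem headProfile_link {w : ℕ → ℝ} {n i : ℕ} {τ q : ℝ} (hτ : w n ^ 2 + (q * τ) ^ 2 = τ ^ 2)
    (hi : i < n) :
    (headProfile w n τ i - headProfile w n τ (i + 1)) ^ 2
      ≤ psum (sqIncr w) n - psum (sqIncr w) i + ((1 - q) * τ) ^ 2 := by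
  cases i with
  | zero =>
    have := psum_nonneg (sqIncr_nonneg w) n
    have h0 : psum (sqIncr w) 0 = 0 := rfl
    simp only [headProfile, Nat.zero_sub, Nat.add_sub_cancel, sub_self, h0]
    nlinarith [sq_nonneg ((1 - q) * τ)]
  | succ j =>
    obtain ⟨m, rfl⟩ : ∃ m, n = j + m + 1 := ⟨n - 1 - j, by omega⟩
    have h := sq_sqrt_sub_sqrt_le (range (m + 1))
      (fun l => if l < m then w (j + l + 1) else τ) (fun l => if l < m then w (j + 1 + l + 1) else
          q * τ)
    have e : ∀ a b : ℕ → ℝ, ∀ c d : ℝ, ∀ F : ℝ → ℝ → ℝ,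
        ∑ l ∈ range (m + 1), F (if l < m then a l else c) (if l < m then b l else d)
          = ∑ l ∈ range m, F (a l) (b l) + F c d := by
      intro a b c d F
      rw [sum_range_succ, if_neg (lt_irrefl m), if_neg (lt_irrefl m)]
      congr 1
      exact sum_congr rfl fun l hl => by rw [if_pos (mem_range.1 hl), if_pos (mem_range.1 hl)]
    have e1 := e (fun l => w (j + l + 1)) (fun l => w (j + 1 + l + 1)) τ (q * τ) (fun a _ => a ^ 2)
    have e2 := e (fun l => w (j + l + 1)) (fun l => w (j + 1 + l + 1)) τ (q * τ) (fun _ b => b ^ 2)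
    have e3 := e (fun l => w (j + l + 1)) (fun l => w (j + 1 + l + 1)) τ (q * τ)
      (fun a b => (a - b) ^ 2)
    have p1 := psum_add (fun l => w l ^ 2) j m
    have p2 := psum_add (fun l => w l ^ 2) (j + 1) m
    have p3 := psum_add (sqIncr w) (j + 1) m
    have p4 := psum_succ (fun l => w l ^ 2) (j + m)
    simp only [show j + 1 + m = j + m + 1 by omega] at p2 p3
    have e4 : ∀ l, sqIncr w (j + 1 + l + 1) = (w (j + l + 1) - w (j + 1 + l + 1)) ^ 2 := fun l => by
      rw [sqIncr, Nat.add_sub_cancel, show j + 1 + l = j + l + 1 by omega]; ring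
    simp only [e4] at p3
    rw [e1, e2, e3] at h
    simp only [headProfile, Nat.add_sub_cancel]
    have a1 : psum (fun l => w l ^ 2) (j + m) - psum (fun l => w l ^ 2) j + τ ^ 2
        = ∑ l ∈ range m, w (j + l + 1) ^ 2 + τ ^ 2 := by linarith
    have a2 : psum (fun l => w l ^ 2) (j + m) - psum (fun l => w l ^ 2) (j + 1) + τ ^ 2
        = ∑ l ∈ range m, w (j + 1 + l + 1) ^ 2 + (q * τ) ^ 2 := by linarith
    rw [a1, a2]
    refine h.trans (le_of_eq ?_)
    rw [p3]; ring

set_option maxHeartbeats 1000000 in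
theorem hasGoodCutoff_of_weight_bounds {K n : ℕ} (hn : 2 ≤ n) {γ s M R : ℝ} {w : ℕ → ℝ}
    (hγ0 : 0 ≤ γ) (hγ : γ ≤ 1) (hs : 0 ≤ s) (hM : 0 < M)
    (hR : 3 / 2 + 4 * γ ≤ R) (hR' : γ ≤ 1 / 3 → 3 / 2 + 6 * γ ≤ R)
    (hw0 : w 0 = 0) (hwn : ∀ j, n < j → w j = 0) (hpos : w n ≠ 0)
    (hend : w (n - 1) = (1 + γ) * w n)
    (hY : psum (sqIncr w) n ≤ M ^ 2 * psum (fun l => w l ^ 2) n - (γ + M ^ 2) * w n ^ 2)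
    (hYR : psum (sqIncr w) n + R * w n ^ 2 ≤ 2 * M * psum (fun l => w l ^ 2) n)
    {U V x y : ℕ → ℝ}
    (hU0 : U 0 = 0) (hV0 : V 0 = 0) (hUN : U (K + 1 + n + 1) = 0) (hVN : V (K + 1 + n + 1) = 0)
    (hVpos : 0 < ∑ i ∈ range (K + 1 + n), V (i + 1) ^ 2)
    (hx : ∀ i ≤ K + 1 + n, |x (i + 1)| ≤ 1 / (1 + γ) * (U (i + 1) * V i))
    (hy : ∀ i ≤ K + 1 + n, |y i| ≤ γ / (1 + γ) * (U i * V (i + 1)))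
    (hloc : ∀ i < K + 1 + n, s * (U (i + 1) ^ 2 - V (i + 1) ^ 2)
      = x (i + 1) + y (i + 1) - x (i + 2) - y i) :
    HasGoodCutoff (K + 1 + n) n s (1 / (1 + γ)) (γ / (1 + γ)) M U V x y := by
  obtain ⟨g, e₀, e, H, u, v, hg0, hg1, he₀, heH, hp, huv⟩ :=
    exists_isAdmissibleParam (pow_pos hM 2) hs hγ0 hγ hR hR'
  have hω : 0 < w n ^ 2 := by positivity
  have h1γ : 0 < 1 + γ := by linarith
  have he₀0 : 0 ≤ e₀ := by rw [he₀]; positivity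
  have he1 : 1 + e₀ = (1 + g) ^ 2 / (4 * g) := by rw [he₀]; field_simp; ring
  set ω := w n ^ 2 with hωdef
  set α := 1 / (1 + γ) with hα
  set β := γ / (1 + γ) with hβ
  have hα0 : 0 ≤ α := by positivity
  have hβ0 : 0 ≤ β := by positivity
  have hβγ : β ≤ γ := by rw [hβ, div_le_iff₀ h1γ]; nlinarith
  have hαβ : α + β = 1 := by rw [hα, hβ]; field_simp
  set τ := √(ω * (1 + e₀)) with hτdef
  have hτ2 : τ ^ 2 = ω * (1 + e₀) := Real.sq_sqrt (by positivity)
  set q := (1 - g) / (1 + g) with hq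
  have hτq : ω + (q * τ) ^ 2 = τ ^ 2 := by
    rw [mul_pow, hτ2, he1, hq]; field_simp; ring
  have hf : ((1 - q) * τ) ^ 2 = g * ω := by
    rw [mul_pow, hτ2, he1, hq]; field_simp; ring
  have he : 0 ≤ e := by rcases heH with ⟨rfl, _⟩ | ⟨rfl, _⟩ <;> positivity
  have hH : 0 ≤ H := by rcases heH with ⟨_, rfl⟩ | ⟨_, rfl⟩ <;> positivity
  have hSm := psum_mono (F := fun l => w l ^ 2) (fun l => sq_nonneg _)
  have hSn : psum (fun l => w l ^ 2) n = psum (fun l => w l ^ 2) (n - 1) + ω := by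
    conv_lhs => rw [show n = n - 1 + 1 by omega, psum_succ, show n - 1 + 1 = n by omega]
  have hSn1 : psum (fun l => w l ^ 2) (n - 1)
      = psum (fun l => w l ^ 2) (n - 1 - 1) + w (n - 1) ^ 2 := by
    conv_lhs => rw [show n - 1 = n - 1 - 1 + 1 by omega, psum_succ,
      show n - 1 - 1 + 1 = n - 1 by omega]
  have hSpos : 0 < psum (fun l => w l ^ 2) n := by
    rw [hSn]; linarith [psum_nonneg (F := fun l => w l ^ 2) (fun l => sq_nonneg _) (n - 1)]
  obtain ⟨p, hpn, hp1, hpe, hprow⟩ : ∃ p ≤ n, n - 1 ≤ p ∧ headProfile w n τ p ^ 2 = ω + e * ω ∧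
      ∀ a b : ℝ, (α * |headProfile w n τ (min (n - 1) p) - headProfile w n τ p| * a
          + β * |headProfile w n τ p| * b) ^ 2
        ≤ α * (headProfile w n τ (min (n - 1) p) - headProfile w n τ p) ^ 2 * a ^ 2
          + β * (H * ω) * b ^ 2 := by
    rcases heH with ⟨rfl, rfl⟩ | ⟨rfl, rfl⟩
    · have hsq : headProfile w n τ n ^ 2 = ω + e * ω := by
        rw [headProfile_sq τ le_rfl, hτ2]; ring
      refine ⟨n, le_rfl, by omega, hsq, fun a b => ?_⟩
      have h := sq_convex_le (a := |headProfile w n τ (min (n - 1) n) - headProfile w n τ n| * a)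
        (b := |headProfile w n τ n| * b) hα0 hβ0 hαβ
      rw [mul_pow, mul_pow, sq_abs, sq_abs, hsq] at h
      linarith
    · have hsq : headProfile w n τ (n - 1) ^ 2 = ω + (e₀ + (1 + γ) ^ 2) * ω := by
        rw [headProfile_sq τ (by omega), hτ2, hSn1, hend, mul_pow, ← hωdef]; ring
      refine ⟨n - 1, by omega, le_rfl, hsq, fun a b => le_of_eq ?_⟩
      rw [min_self, sub_self, abs_zero, mul_zero, zero_mul, zero_add, mul_pow, mul_pow, sq_abs, hsq]
      ring
  set φ₀ : ℕ → ℝ := fun i => if i ≤ n then headProfile w n τ (min i p) else 0 with hφ₀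
  have hφn : φ₀ n = headProfile w n τ p := by
    simp only [hφ₀, le_refl, if_true, min_eq_right hpn]
  have hφn1 : φ₀ (n - 1) = headProfile w n τ (min (n - 1) p) := by
    simp only [hφ₀]; rw [if_pos (by omega)]
  refine hasGoodCutoff_of_weights (w := w) (φ₀ := φ₀) (ω := ω) (f := g * ω) (e := e * ω)
    (H := H * ω) (Ub := psum (sqIncr w) n / 2 + u * ω) (Vb := psum (sqIncr w) n / 2 + v * ω)
    hα0 hβ0 hαβ hs hM.le hw0 hwn rfl (by omega) (by positivity) (by positivity) (by positivity)
    (mul_le_of_le_one_left hω.le hg1) hSpos ?_ ?_ (by rw [hφn, hpe])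
        (fun i hi => if_neg (by omega)) ?_
    hU0 hV0 hUN hVN hVpos hx hy hloc ?_ ?_ ?_ ?_ ?_ ?_ ?_
  · intro i hi
    simp only [hφ₀]
    rw [if_pos (by omega), headProfile_sq τ (by omega), hτ2, hSn]
    have := hSm (show min (i + 1) p - 1 ≤ i by omega)
    linarith [mul_nonneg hω.le he₀0]
  · intro i hi
    simp only [hφ₀]
    rw [if_pos (by omega), if_pos (by omega), ← hf]
    rcases Nat.lt_or_ge i p with h | h
    · rw [min_eq_left h.le, min_eq_left (by omega)]
      exact headProfile_link hτq hi
    · rw [min_eq_right h, min_eq_right (by omega), sub_self]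
      have := psum_mono (sqIncr_nonneg w) hi.le
      linarith [sq_nonneg ((1 - q) * τ)]
  · rw [hφn, hφn1]; exact hprow
  · linarith [mul_le_mul_of_nonneg_right hp.u_ge hω.le]
  · linarith [mul_le_mul_of_nonneg_right hp.u_ge' hω.le]
  · linarith [mul_le_mul_of_nonneg_right hp.v_ge hω.le]
  · linarith [mul_le_mul_of_nonneg_right hp.v_ge' hω.le]
  · linarith [mul_le_mul_of_nonneg_right hp.v_ge'' hω.le]
  · linarith [mul_le_mul_of_nonneg_right hβγ hω.le, mul_nonneg (sq_nonneg M) hω.le]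
  · linarith [mul_le_mul_of_nonneg_right huv hω.le]

theorem two_sin_half_mul_cos (n t : ℝ) :
    2 * Real.sin (t / 2) * Real.cos ((n + 1 / 2) * t) = Real.sin ((n + 1) * t) - Real.sin (n * t)
        := by
  rw [Real.sin_sub_sin]
  congr 2
  · congr 1; ring_nf
  · ring_nf

/-- The defining equation of `theta` has a solution, and `theta` is one. -/
theorem theta_spec {c : ℝ} (hc0 : 0 ≤ c) (hc : c ≤ 1 / 4) {n : ℕ} (hn : 1 ≤ n) :
    SpecIncl.theta c n ∈ Set.Icc (Real.pi / (2 * (n : ℝ) + 1)) (Real.pi / ((n : ℝ) + 2)) ∧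
    Real.sin (((n : ℝ) + 1) * SpecIncl.theta c n) - Real.sin (n * SpecIncl.theta c n)
      + c * Real.sin (((n : ℝ) - 1) * SpecIncl.theta c n) = 0 := by
  have hn' : (1 : ℝ) ≤ n := by exact_mod_cast hn
  have hπ := Real.pi_pos
  set F : ℝ → ℝ := fun t => 2 * Real.sin (t / 2) * Real.cos (((n : ℝ) + 1 / 2) * t)
      + c * Real.sin (((n : ℝ) - 1) * t) with hF
  have hFc : Continuous F := by fun_prop
  set a := Real.pi / (2 * (n : ℝ) + 1) with ha
  set b := Real.pi / ((n : ℝ) + 2) with hb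
  have hab : a ≤ b := div_le_div_of_nonneg_left hπ.le (by linarith) (by linarith)
  have ha0 : 0 < a := by positivity
  have hb0 : 0 < b := by positivity
  have hFa : 0 ≤ F a := by
    have e1 : ((n : ℝ) + 1 / 2) * a = Real.pi / 2 := by rw [ha]; field_simp
    have e2 : ((n : ℝ) - 1) * a ≤ Real.pi := by
      rw [ha, mul_div_assoc', div_le_iff₀ (by linarith)]; nlinarith
    simp only [hF]
    rw [e1, Real.cos_pi_div_two, mul_zero, zero_add]
    exact mul_nonneg hc0 (Real.sin_nonneg_of_nonneg_of_le_pi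
      (mul_nonneg (by linarith) ha0.le) e2)
  have hFb : F b ≤ 0 := by
    have e0 : ((n : ℝ) + 2) * b = Real.pi := by rw [hb]; field_simp
    have hb3 : b ≤ Real.pi / 3 := div_le_div_of_nonneg_left hπ.le (by norm_num) (by linarith)
    simp only [hF]
    rw [two_sin_half_mul_cos, show ((n : ℝ) + 1) * b = Real.pi - b by linarith,
      show (n : ℝ) * b = Real.pi - 2 * b by linarith,
      show ((n : ℝ) - 1) * b = Real.pi - 3 * b by linarith, Real.sin_pi_sub, Real.sin_pi_sub,
      Real.sin_pi_sub]
    have h1 : 0 ≤ Real.sin b := Real.sin_nonneg_of_nonneg_of_le_pi hb0.le (by linarith)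
    have h2 : 0 ≤ Real.sin (3 * b) :=
      Real.sin_nonneg_of_nonneg_of_le_pi (by linarith) (by linarith)
    have h3 : 1 / 2 ≤ Real.cos b := by
      rw [← Real.cos_pi_div_three]
      exact Real.cos_le_cos_of_nonneg_of_le_pi hb0.le (by linarith) hb3
    have h4 := Real.cos_le_one b
    have h5 : Real.sin (3 * b) = Real.sin b * (4 * Real.cos b ^ 2 - 1) := by
      rw [Real.sin_three_mul]
      have := Real.sin_sq_add_cos_sq b
      linear_combination (-4 * Real.sin b) * this
    have h6 : Real.sin b * ((Real.cos b - 1 / 2) * (Real.cos b - 3 / 2)) ≤ 0 :=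
      mul_nonpos_of_nonneg_of_nonpos h1 (mul_nonpos_of_nonneg_of_nonpos (by linarith) (by linarith))
    have h7 := mul_le_mul_of_nonneg_right hc h2
    rw [Real.sin_two_mul]
    rw [h5] at h7 ⊢
    nlinarith
  obtain ⟨t, ht, htF⟩ := intermediate_value_Icc' hab hFc.continuousOn ⟨hFb, hFa⟩
  have hmem : SpecIncl.theta c n ∈ {t : ℝ | t ∈ Set.Icc a b ∧ F t = 0} := by
    refine IsClosed.csInf_mem ?_ ⟨t, ht, htF⟩ ⟨a, fun z hz => hz.1.1⟩
    exact isClosed_Icc.inter (isClosed_eq hFc continuous_const)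
  refine ⟨hmem.1, ?_⟩
  have := hmem.2
  simp only [hF] at this
  rwa [two_sin_half_mul_cos] at this

theorem psum_sqIncr_eq {a w : ℕ → ℝ} {μ : ℝ} {n : ℕ} (ha : ∀ j, a (j + 2) = (2 - μ) * a (j + 1) -
    a j)
    (hw0 : w 0 = 0) (hw : ∀ j, j < n → w (j + 1) = a (j + 1)) {j : ℕ} (hj : j < n) :
    psum (sqIncr w) (j + 1) = μ * psum (fun l => w l ^ 2) (j + 1) + a 1 * a 0
      + a (j + 1) * (a (j + 2) - a (j + 1)) := by
  induction j with
  | zero =>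
    rw [psum_succ, psum_succ, sqIncr, hw 0 hj, Nat.add_sub_cancel, hw0, ha 0]
    simp [psum]; ring
  | succ j ih =>
    rw [psum_succ, psum_succ (fun l => w l ^ 2), ih (by omega), sqIncr, Nat.add_sub_cancel,
      hw (j + 1) hj, hw j (by omega), ha (j + 1), ha j]
    ring

theorem invariant_eq {a : ℕ → ℝ} {μ : ℝ} (ha : ∀ j, a (j + 2) = (2 - μ) * a (j + 1) - a j) (j : ℕ) :
    a (j + 1) ^ 2 + a j ^ 2 - (2 - μ) * a (j + 1) * a j
      = a 1 ^ 2 + a 0 ^ 2 - (2 - μ) * a 1 * a 0 := by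
  induction j with
  | zero => rfl
  | succ j ih => rw [← ih, ha j]; ring

theorem psum_sqIncr_invariant {a w : ℕ → ℝ} {μ c : ℝ} {n : ℕ}
    (ha : ∀ j, a (j + 2) = (2 - μ) * a (j + 1) - a j)
    (hc : a 1 ^ 2 + a 0 ^ 2 - (2 - μ) * a 1 * a 0 = c)
    (hw0 : w 0 = 0) (hw : ∀ j, j < n → w (j + 1) = a (j + 1)) {j : ℕ} (hj : j < n) :
    (1 - μ / 2) * (psum (sqIncr w) (j + 1) - a 1 ^ 2) + μ * psum (fun l => w l ^ 2) (j + 1)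
      - μ * (a 1 ^ 2 + a (j + 1) ^ 2) / 2 = j * c := by
  induction j with
  | zero =>
    rw [psum_succ, psum_succ, sqIncr, hw 0 hj, Nat.add_sub_cancel, hw0]
    simp [psum]; ring
  | succ j ih =>
    have hi := ih (by omega)
    have hc' := invariant_eq ha (j + 1)
    rw [hc] at hc'
    rw [psum_succ, psum_succ (fun l => w l ^ 2), sqIncr, Nat.add_sub_cancel,
      hw (j + 1) hj, hw j (by omega)]
    push_cast
    linear_combination hi + hc'

theorem ratio_bound {M h L : ℝ} (hM0 : 0 < M) (hM : M ≤ 1) (hh : 0 ≤ h)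
    (hL : 3 / 2 + 2 / 5 * M ≤ L) :
    (3 / 2 + 3 * (h * M) - M ^ 2) * (1 + M / 2)
      ≤ L * h ^ 2 + L * (1 + h * M) + (1 - M ^ 2 / 2) * (h + M) + M / 2 := by
  have h1 : (3 / 2 + 2 / 5 * M) * (h ^ 2 + (1 + h * M)) ≤ L * (h ^ 2 + (1 + h * M)) :=
    mul_le_mul_of_nonneg_right hL (by positivity)
  nlinarith [sq_nonneg (h - M * (5 / 6)), mul_nonneg hM0.le (sub_nonneg.2 hM), mul_nonneg hh hM0.le,
    mul_nonneg (mul_nonneg hh hM0.le) (sub_nonneg.2 hM), mul_nonneg hh (sub_nonneg.2 hM)]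

theorem ratio_bound' {M h L : ℝ} (hM0 : 0 < M) (hM : M ≤ 1) (hh : 0 ≤ h) (hhM : h * M ≤ 1 / 3)
    (hL : 3 / 2 + 2 / 5 * M ≤ L) :
    (3 / 2 + 5 * (h * M) - M ^ 2) * (1 + M / 2)
      ≤ L * h ^ 2 + L * (1 + h * M) + (1 - M ^ 2 / 2) * (h + M) + M / 2 := by
  have h1 : (3 / 2 + 2 / 5 * M) * (h ^ 2 + (1 + h * M)) ≤ L * (h ^ 2 + (1 + h * M)) :=
    mul_le_mul_of_nonneg_right hL (by positivity)
  nlinarith [sq_nonneg (h - M * (5 / 6)), mul_nonneg hM0.le (sub_nonneg.2 hM), mul_nonneg hh hM0.le,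
    mul_nonneg (mul_nonneg hh hM0.le) (sub_nonneg.2 hM), mul_nonneg hh (sub_nonneg.2 hM),
    mul_nonneg hM0.le (sub_nonneg.2 hhM)]

theorem mul_two_sin_half_ge {m : ℕ} {θ : ℝ} (hθ0 : 0 < θ) (hθ : θ ≤ Real.pi / 3)
    (hm : Real.pi ≤ (2 * m - 1) * θ) :
    3 / 2 + 2 / 5 * (2 * Real.sin (θ / 2)) ≤ m * (2 * Real.sin (θ / 2)) := by
  have hπ1 := Real.pi_gt_d2
  have hπ2 := Real.pi_lt_d2
  have hθ1 : θ ≤ 1.05 := by linarith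
  have hs := Real.sin_gt_sub_cube (show 0 < θ / 2 by linarith)
  have hθ3 : 0 < θ ^ 3 := by positivity
  have hle : Real.sin (θ / 2) ≤ θ / 2 := Real.sin_le (by linarith)
  have hm0 : (0 : ℝ) ≤ m := Nat.cast_nonneg m
  have h1 : m * (θ * (1 - θ ^ 2 / 16)) ≤ m * (2 * Real.sin (θ / 2)) :=
    mul_le_mul_of_nonneg_left (by nlinarith) hm0
  have h2 : (3.14 + θ) / 2 * (1 - θ ^ 2 / 16) ≤ m * θ * (1 - θ ^ 2 / 16) :=
    mul_le_mul_of_nonneg_right (by linarith) (by nlinarith)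
  have h3 : 3 / 2 + 2 / 5 * θ ≤ (3.14 + θ) / 2 * (1 - θ ^ 2 / 16) := by
    nlinarith [mul_nonneg hθ0.le (sub_nonneg.2 hθ1),
      mul_nonneg (mul_nonneg hθ0.le hθ0.le) (sub_nonneg.2 hθ1)]
  linarith

theorem ratio_mul_le {S Y ω M γ a b κ : ℝ} {m : ℕ} (hM0 : 0 < M) (hM : M ≤ 1) (hω : 0 ≤ ω)
    (hab : a * b ≤ 0)
    (hY : Y = M ^ 2 * S + a * b - (γ + M ^ 2) * ω)
    (hI : (1 - M ^ 2 / 2) * (Y - a ^ 2) + M ^ 2 * S - M ^ 2 * (a ^ 2 + ω) / 2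
      = m * (ω * (γ ^ 2 + M ^ 2 * (1 + γ))))
    (hκ : (3 / 2 + κ * γ - M ^ 2) * (1 + M / 2)
      ≤ m * M * (γ / M) ^ 2 + m * M * (1 + γ) + (1 - M ^ 2 / 2) * (γ / M + M) + M / 2) :
    (3 / 2 + (κ + 1) * γ) * ω ≤ 2 * M * S - Y := by
  have hM2 : M ^ 2 ≤ 1 := by nlinarith
  have hQ : M * (m * M * (γ / M) ^ 2 + m * M * (1 + γ) + (1 - M ^ 2 / 2) * (γ / M + M) + M / 2)
      = m * (γ ^ 2 + M ^ 2 * (1 + γ)) + (1 - M ^ 2 / 2) * (γ + M ^ 2) + M ^ 2 / 2 := by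
    field_simp
  have h1 := mul_le_mul_of_nonneg_left hκ hM0.le
  rw [hQ] at h1
  have h2 := mul_le_mul_of_nonneg_left h1 hω
  have h3 : (1 - M ^ 2 / 2) * (a * b) ≤ 0 :=
    mul_nonpos_of_nonneg_of_nonpos (by linarith) hab
  have h4 : 0 ≤ a ^ 2 := sq_nonneg a
  have h5 : (M * (1 + M / 2)) * (ω * (3 / 2 + κ * γ - M ^ 2))
      ≤ (M * (1 + M / 2)) * (2 * M * S * (1 - M / 2)) := by
    rw [hY] at hI
    nlinarith
  have h6 := le_of_mul_le_mul_left h5 (by positivity)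
  rw [hY]
  nlinarith

set_option maxHeartbeats 1000000 in
theorem hasGoodCutoff_of_theta {K p : ℕ} (hp : 1 ≤ p) {γ s : ℝ} (hγ0 : 0 ≤ γ) (hγ : γ ≤ 1)
    (hs : 0 ≤ s) {U V x y : ℕ → ℝ}
    (hU0 : U 0 = 0) (hV0 : V 0 = 0) (hUN : U (K + 1 + (p + 2) + 1) = 0)
    (hVN : V (K + 1 + (p + 2) + 1) = 0)
    (hVpos : 0 < ∑ i ∈ range (K + 1 + (p + 2)), V (i + 1) ^ 2)
    (hx : ∀ i ≤ K + 1 + (p + 2), |x (i + 1)| ≤ 1 / (1 + γ) * (U (i + 1) * V i))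
    (hy : ∀ i ≤ K + 1 + (p + 2), |y i| ≤ γ / (1 + γ) * (U i * V (i + 1)))
    (hloc : ∀ i < K + 1 + (p + 2), s * (U (i + 1) ^ 2 - V (i + 1) ^ 2)
      = x (i + 1) + y (i + 1) - x (i + 2) - y i) :
    HasGoodCutoff (K + 1 + (p + 2)) (p + 2) s (1 / (1 + γ)) (γ / (1 + γ))
      (2 * Real.sin (SpecIncl.theta (1 / (1 + γ) * (γ / (1 + γ))) p / 2)) U V x y := by
  have hγ1 : 0 < 1 + γ := by linarith
  set α := 1 / (1 + γ) with hα
  set β := γ / (1 + γ) with hβ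
  have hαβ : α + β = 1 := by rw [hα, hβ]; field_simp
  have hα0 : 0 < α := by positivity
  have hβ0 : 0 ≤ β := by positivity
  have hβ2 : β ≤ 1 / 2 := by rw [hβ, div_le_iff₀ hγ1]; linarith
  obtain ⟨⟨hθl, hθu⟩, heq⟩ := theta_spec (c := α * β) (by positivity)
    (by nlinarith [sq_nonneg (α - β)]) hp
  set θ := SpecIncl.theta (α * β) p with hθdef
  have hπ := Real.pi_pos
  have hp1 : (1 : ℝ) ≤ p := by exact_mod_cast hp
  have hθ0 : 0 < θ := lt_of_lt_of_le (by positivity) hθl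
  have hθ3 : θ ≤ Real.pi / 3 :=
    hθu.trans (div_le_div_of_nonneg_left hπ.le (by norm_num) (by linarith))
  have hpθ : ((p : ℝ) + 2) * θ ≤ Real.pi := by
    rw [le_div_iff₀ (by linarith)] at hθu; linarith
  have hpθ' : Real.pi ≤ (2 * ((p + 1 : ℕ) : ℝ) - 1) * θ := by
    rw [div_le_iff₀ (by linarith)] at hθl; push_cast; linarith
  set M := 2 * Real.sin (θ / 2) with hM
  have hM0 : 0 < M := by
    have := Real.sin_pos_of_pos_of_lt_pi (show 0 < θ / 2 by linarith) (by linarith)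
    linarith
  have hM1 : M ≤ 1 := by
    have : Real.sin (θ / 2) ≤ Real.sin (Real.pi / 6) :=
      Real.sin_le_sin_of_le_of_le_pi_div_two (by linarith) (by linarith) (by linarith)
    rw [Real.sin_pi_div_six] at this
    linarith
  have hcos : 2 - M ^ 2 = 2 * Real.cos θ := by
    have h := Real.cos_two_mul (θ / 2)
    have h' := Real.sin_sq_add_cos_sq (θ / 2)
    rw [show 2 * (θ / 2) = θ by ring] at h
    rw [hM]; nlinarith
  have hL := mul_two_sin_half_ge hθ0 hθ3 hpθ'
  rw [← hM] at hL
  have hsin0 : 0 < Real.sin θ := Real.sin_pos_of_pos_of_lt_pi hθ0 (by linarith)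
  have hcos1 : 2 * Real.cos θ < 2 := by rw [← hcos]; nlinarith
  have hβc : 0 < 1 - β * (2 * Real.cos θ) := by
    have h0 : 0 ≤ 2 * Real.cos θ := by rw [← hcos]; nlinarith
    have := mul_nonneg (sub_nonneg.2 hβ2) h0
    linarith
  set a : ℕ → ℝ := fun j => Real.sin (((j : ℝ) - 1) * θ) - β * Real.sin (((j : ℝ) - 2) * θ) with ha
  have hrec : ∀ j, a (j + 2) = (2 - M ^ 2) * a (j + 1) - a j := by
    intro j
    have key : ∀ t : ℝ, Real.sin (t + θ) = 2 * Real.cos θ * Real.sin t - Real.sin (t - θ) := by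
      intro t; rw [Real.sin_add, Real.sin_sub]; ring
    have k1 := key ((j : ℝ) * θ)
    have k2 := key (((j : ℝ) - 1) * θ)
    rw [hcos]
    simp only [ha]
    push_cast
    rw [show ((j : ℝ) + 2 - 1) * θ = j * θ + θ by ring, k1,
      show ((j : ℝ) + 2 - 2) * θ = (j - 1) * θ + θ by ring, k2,
      show ((j : ℝ) + 1 - 1) * θ = j * θ by ring, show ((j : ℝ) + 1 - 2) * θ = (j - 1) * θ by ring,
      show (j : ℝ) * θ - θ = (j - 1) * θ by ring, show ((j : ℝ) - 1) * θ - θ = (j - 2) * θ by ring]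
    ring
  have ha1 : a 1 = β * Real.sin θ := by
    simp only [ha]; norm_num
  have ha0 : a 0 = -Real.sin θ * (1 - β * (2 * Real.cos θ)) := by
    simp only [ha]; norm_num [Real.sin_two_mul]; ring
  have hprod : a 1 * a 0 ≤ 0 := by
    rw [ha1, ha0]
    have := mul_nonneg (mul_nonneg hβ0 (mul_nonneg hsin0.le hsin0.le)) hβc.le
    linarith
  have haend : a (p + 2) = α * a (p + 1) := by
    simp only [ha]; push_cast
    rw [show ((p : ℝ) + 2 - 1) * θ = (p + 1) * θ by ring,
      show ((p : ℝ) + 2 - 2) * θ = p * θ by ring, show ((p : ℝ) + 1 - 1) * θ = p * θ by ring,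
      show ((p : ℝ) + 1 - 2) * θ = (p - 1) * θ by ring]
    linear_combination heq - Real.sin (p * θ) * hαβ
  have hapos : 0 < a (p + 1) := by
    have e : Real.sin (((p : ℝ) - 1) * θ)
        = 2 * Real.cos θ * Real.sin (p * θ) - Real.sin ((p + 1) * θ) := by
      rw [sub_mul, add_mul, one_mul, Real.sin_add, Real.sin_sub]; ring
    simp only [ha]; push_cast
    rw [show ((p : ℝ) + 1 - 1) * θ = p * θ by ring,
      show ((p : ℝ) + 1 - 2) * θ = (p - 1) * θ by ring, e]
    have s1 : 0 < Real.sin (p * θ) :=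
      Real.sin_pos_of_pos_of_lt_pi (by positivity) (by linarith)
    have s2 : 0 < Real.sin ((p + 1) * θ) :=
      Real.sin_pos_of_pos_of_lt_pi (by positivity) (by linarith)
    linarith [mul_pos s1 hβc, mul_nonneg hβ0 s2.le]
  have haend' : a (p + 1) = (1 + γ) * a (p + 2) := by
    rw [haend, hα]; field_simp
  have hapos' : 0 < a (p + 2) := by rw [haend]; positivity
  set w : ℕ → ℝ := fun j => if 1 ≤ j ∧ j ≤ p + 2 then a j else 0 with hw
  have hw0 : w 0 = 0 := by simp [hw]
  have hwa : ∀ j, j < p + 2 → w (j + 1) = a (j + 1) := by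
    intro j hj; simp only [hw]; rw [if_pos ⟨by omega, by omega⟩]
  have hwn : ∀ j, p + 2 < j → w j = 0 := by
    intro j hj; simp only [hw]; rw [if_neg (by omega)]
  have hwe : w (p + 2) = a (p + 2) := hwa (p + 1) (by omega)
  have hYeq := psum_sqIncr_eq hrec hw0 hwa (show p + 1 < p + 2 by omega)
  have hI := psum_sqIncr_invariant (c := a (p + 2) ^ 2 * (γ ^ 2 + M ^ 2 * (1 + γ))) hrec
    (by rw [← invariant_eq hrec (p + 1), haend']; ring) hw0 hwa (show p + 1 < p + 2 by omega)
  have hY : psum (sqIncr w) (p + 2) = M ^ 2 * psum (fun l => w l ^ 2) (p + 2) + a 1 * a 0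
      - (γ + M ^ 2) * a (p + 2) ^ 2 := by
    rw [hYeq, hrec (p + 1), haend']; ring
  have hω : 0 < a (p + 2) ^ 2 := by positivity
  have hγM : γ / M * M = γ := by field_simp
  have hr1 := ratio_bound hM0 hM1 (show 0 ≤ γ / M by positivity) hL
  rw [hγM] at hr1
  have hR1 := ratio_mul_le hM0 hM1 hω.le hprod hY hI hr1
  refine hasGoodCutoff_of_weight_bounds (R := (2 * M * psum (fun l => w l ^ 2) (p + 2)
      - psum (sqIncr w) (p + 2)) / a (p + 2) ^ 2) (w := w) (by omega) hγ0 hγ hs hM0 ?_ ?_ hw0 hwn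
      ?_ ?_ ?_ ?_ hU0 hV0 hUN hVN hVpos hx hy hloc
  · rw [le_div_iff₀ hω]; linarith
  · intro h3
    have hr2 := ratio_bound' hM0 hM1 (show 0 ≤ γ / M by positivity) (by rw [hγM]; exact h3) hL
    rw [hγM] at hr2
    have hR2 := ratio_mul_le hM0 hM1 hω.le hprod hY hI hr2
    rw [le_div_iff₀ hω]; linarith
  · rw [hwe]; exact hapos'.ne'
  · rw [hwe, show p + 2 - 1 = p + 1 by omega, hwa p (by omega)]; exact haend'
  · rw [hwe, hY]; linarith
  · rw [hwe, div_mul_cancel₀ _ hω.ne']; linarith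

theorem HasGoodCutoff.of_reflect {N n : ℕ} {s α β M : ℝ} {U V x y : ℕ → ℝ}
    (h : HasGoodCutoff N n s β α M (fun i => U (N + 1 - i)) (fun i => V (N + 1 - i))
      (fun i => y (N + 1 - i)) (fun i => x (N + 1 - i))) :
    HasGoodCutoff N n s α β M U V x y := by
  obtain ⟨k, φ, hk, hφ, hpos, hle⟩ := h
  have hV : ∑ i ∈ range N, φ (N + 1 - (i + 1)) ^ 2 * V (i + 1) ^ 2
      = ∑ i ∈ range N, φ (i + 1) ^ 2 * V (N + 1 - (i + 1)) ^ 2 := by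
    rw [← sum_range_reflect]
    refine sum_congr rfl fun i hi => ?_
    have hi := mem_range.1 hi
    rw [show N + 1 - (N - 1 - i + 1) = i + 1 by omega,
      show N - 1 - i + 1 = N + 1 - (i + 1) by omega]
  refine ⟨N - n - k, fun i => φ (N + 1 - i), by omega, fun i h1 h2 h3 => ?_, ?_, ?_⟩
  · have := hφ (N + 1 - i) (by omega) (by omega) h3
    omega
  · simp only [hV]; exact hpos
  · simp only [hV]
    refine le_trans (le_of_eq ?_) hle
    rw [← sum_range_reflect]
    refine sum_congr rfl fun i hi => ?_
    have hi := mem_range.1 hi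
    refine if_congr (by omega) ?_ rfl
    obtain ⟨q, rfl⟩ : ∃ q, N = i + 1 + q := ⟨N - (i + 1), by omega⟩
    unfold rowFunctional
    simp only [show i + 1 + q - 1 - i = q by omega, show i + 1 + q + 1 - (q + 1) = i + 1 by omega,
      show i + 1 + q + 1 - q = i + 2 by omega, show i + 1 + q + 1 - (q + 2) = i by omega,
      show i + 1 + q + 1 - (i + 1) = q + 1 by omega, show i + 1 + q + 1 - i = q + 2 by omega,
      show i + 1 + q + 1 - (i + 2) = q by omega]
    ring

theorem hasGoodCutoff {N p : ℕ} (hp : 1 ≤ p) (hpN : p + 2 < N) {α β s : ℝ} (hα : 0 ≤ α)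
    (hβ : 0 ≤ β) (hαβ : α + β = 1) (hs : 0 ≤ s) {U V x y : ℕ → ℝ}
    (hU0 : U 0 = 0) (hV0 : V 0 = 0) (hUN : U (N + 1) = 0) (hVN : V (N + 1) = 0)
    (hVpos : 0 < ∑ i ∈ range N, V (i + 1) ^ 2)
    (hx : ∀ i ≤ N, |x (i + 1)| ≤ α * (U (i + 1) * V i))
    (hy : ∀ i ≤ N, |y i| ≤ β * (U i * V (i + 1)))
    (hloc : ∀ i < N, s * (U (i + 1) ^ 2 - V (i + 1) ^ 2)
      = x (i + 1) + y (i + 1) - x (i + 2) - y i) :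
    HasGoodCutoff N (p + 2) s α β (2 * Real.sin (SpecIncl.theta (α * β) p / 2)) U V x y := by
  have key : ∀ {α β : ℝ}, 0 ≤ α → 0 ≤ β → α + β = 1 → β ≤ α → ∀ {U V x y : ℕ → ℝ},
      U 0 = 0 → V 0 = 0 → U (N + 1) = 0 → V (N + 1) = 0 → 0 < ∑ i ∈ range N, V (i + 1) ^ 2 →
      (∀ i ≤ N, |x (i + 1)| ≤ α * (U (i + 1) * V i)) →
      (∀ i ≤ N, |y i| ≤ β * (U i * V (i + 1))) →
      (∀ i < N, s * (U (i + 1) ^ 2 - V (i + 1) ^ 2) = x (i + 1) + y (i + 1) - x (i + 2) - y i) →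
      HasGoodCutoff N (p + 2) s α β (2 * Real.sin (SpecIncl.theta (α * β) p / 2)) U V x y := by
    intro α β hα hβ hαβ hle U V x y hU0 hV0 hUN hVN hVpos hx hy hloc
    have hα0 : 0 < α := by linarith
    obtain ⟨K, rfl⟩ : ∃ K, N = K + 1 + (p + 2) := ⟨N - (p + 3), by omega⟩
    have e : 1 + β / α = 1 / α := by field_simp; linarith
    have e1 : 1 / (1 + β / α) = α := by rw [e]; field_simp
    have e2 : β / α / (1 + β / α) = β := by rw [e]; field_simp
    have := hasGoodCutoff_of_theta (K := K) hp (γ := β / α) (by positivity)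
      ((div_le_one hα0).2 hle) hs hU0 hV0 hUN hVN hVpos (by rwa [e1]) (by rwa [e2]) hloc
    rwa [e1, e2] at this
  rcases le_total β α with hle | hle
  · exact key hα hβ hαβ hle hU0 hV0 hUN hVN hVpos hx hy hloc
  · apply HasGoodCutoff.of_reflect
    rw [mul_comm α β]
    refine key hβ hα (by linarith) hle (by simpa using hUN) (by simpa using hVN)
      (by simpa using hU0) (by simpa using hV0) ?_ ?_ ?_ ?_
    · rw [← sum_range_reflect]
      refine lt_of_lt_of_eq hVpos (sum_congr rfl fun i hi => ?_)
      have hi := mem_range.1 hi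
      simp only [show N + 1 - (N - 1 - i + 1) = i + 1 by omega]
    · intro i hi
      have := hy (N - i) (by omega)
      simpa only [show N + 1 - (i + 1) = N - i by omega, show N + 1 - i = N - i + 1 by omega]
    · intro i hi
      have := hx (N - i) (by omega)
      simpa only [show N + 1 - (i + 1) = N - i by omega, show N + 1 - i = N - i + 1 by omega]
    · intro i hi
      have := hloc (N - 1 - i) (by omega)
      simp only [show N + 1 - (i + 1) = N - 1 - i + 1 by omega,
        show N + 1 - i = N - 1 - i + 2 by omega, show N + 1 - (i + 2) = N - 1 - i by omega]
      rw [this]; ring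

/-- A cutoff `φ` supported on a (possibly truncated) window `{i | i ≤ k < i + n}` of `{1, …, N}` for
which the rows of the tridiagonal operator restricted to the window are bounded by `σ`. -/
def HasGoodTruncation (N n : ℕ) (α β σ : ℝ) (F V : ℕ → ℝ) : Prop :=
  ∃ (k : ℕ) (φ : ℕ → ℝ), (∀ i, 1 ≤ i → φ i ≠ 0 → i ≤ k ∧ k < i + n) ∧
    0 < ∑ i ∈ range N, φ (i + 1) ^ 2 * V (i + 1) ^ 2 ∧
    ∑ i ∈ range N, (if i + 1 ≤ k ∧ k < i + 1 + n then
        (|φ (i + 1)| * F (i + 1) + (α * |φ i - φ (i + 1)| * V i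
          + β * |φ (i + 2) - φ (i + 1)| * V (i + 2))) ^ 2 else 0)
      ≤ σ ^ 2 * ∑ i ∈ range N, φ (i + 1) ^ 2 * V (i + 1) ^ 2

theorem sum_add_sq_le {ι : Type*} (t : Finset ι) (p q : ι → ℝ) {s M X : ℝ} (hs : 0 ≤ s)
    (hM : 0 ≤ M) (hX : 0 ≤ X) (hp : ∑ i ∈ t, p i ^ 2 ≤ s ^ 2 * X)
    (hq : ∑ i ∈ t, q i ^ 2 ≤ M ^ 2 * X) : ∑ i ∈ t, (p i + q i) ^ 2 ≤ (s + M) ^ 2 * X := by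
  have h := Real.sum_mul_le_sqrt_mul_sqrt t p q
  have h1 : √(∑ i ∈ t, p i ^ 2) ≤ s * √X := by
    rw [← Real.sqrt_sq hs, ← Real.sqrt_mul (sq_nonneg s)]; exact Real.sqrt_le_sqrt hp
  have h2 : √(∑ i ∈ t, q i ^ 2) ≤ M * √X := by
    rw [← Real.sqrt_sq hM, ← Real.sqrt_mul (sq_nonneg M)]; exact Real.sqrt_le_sqrt hq
  have h3 : ∑ i ∈ t, p i * q i ≤ s * M * X := by
    refine h.trans ((mul_le_mul h1 h2 (Real.sqrt_nonneg _) (by positivity)).trans (le_of_eq ?_))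
    rw [mul_mul_mul_comm, Real.mul_self_sqrt hX]
  have e : ∑ i ∈ t, (p i + q i) ^ 2
      = ∑ i ∈ t, p i ^ 2 + ∑ i ∈ t, q i ^ 2 + 2 * ∑ i ∈ t, p i * q i := by
    rw [mul_sum, ← sum_add_distrib, ← sum_add_distrib]
    exact sum_congr rfl fun _ _ => by ring
  rw [e]; linarith

theorem sum_range_sub_eq_psum {g : ℕ → ℝ} (hg0 : g 0 = 0) {n : ℕ} (hgn : ∀ j, n < j → g j = 0)
    {N i : ℕ} (hi : i < N) : ∑ k ∈ range (N + n + 1), g (k + 1 - (i + 1)) = psum g n := by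
  obtain ⟨q, hq⟩ : ∃ q, N + n + 1 = i + 1 + (n + q) := ⟨N - (i + 1) + 1, by omega⟩
  rw [hq, sum_range_add]
  have h1 : ∑ k ∈ range (i + 1), g (k + 1 - (i + 1)) = 0 :=
    sum_eq_zero fun k hk => by
      have := mem_range.1 hk
      rw [show k + 1 - (i + 1) = 0 by omega, hg0]
  rw [h1, zero_add, ← psum_eq_of_le hgn (show n ≤ n + q by omega)]
  exact sum_congr rfl fun k _ => by rw [show i + 1 + k + 1 - (i + 1) = k + 1 by omega]

theorem hasGoodTruncation_of_weights {N n : ℕ} {α β s M : ℝ} (hα : 0 ≤ α) (hβ : 0 ≤ β)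
    (hαβ : α + β = 1) (hs : 0 ≤ s) (hM : 0 ≤ M) {w : ℕ → ℝ} (hw0 : w 0 = 0)
    (hwn : ∀ j, n < j → w j = 0) (hwpos : 0 < psum (fun l => w l ^ 2) n)
    (hw : α * psum (fun l => (w (l + 1) - w l) ^ 2) n + β * psum (sqIncr w) n
      ≤ M ^ 2 * psum (fun l => w l ^ 2) n)
    {F V : ℕ → ℝ} (hV0 : V 0 = 0) (hVN : V (N + 1) = 0)
    (hVpos : 0 < ∑ i ∈ range N, V (i + 1) ^ 2)
    (hF : ∑ i ∈ range N, F (i + 1) ^ 2 ≤ s ^ 2 * ∑ i ∈ range N, V (i + 1) ^ 2) :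
    HasGoodTruncation N n α β (s + M) F V := by
  set T := ∑ i ∈ range N, V (i + 1) ^ 2
  set S := psum (fun l => w l ^ 2) n
  have hsum : ∀ (g : ℕ → ℝ), g 0 = 0 → (∀ j, n < j → g j = 0) → ∀ G : ℕ → ℝ,
      ∑ p ∈ range (N + n + 1) ×ˢ range N, g (p.1 + 1 - (p.2 + 1)) * G p.2
        = psum g n * ∑ i ∈ range N, G i := by
    intro g hg0 hgn G
    rw [sum_product_right, mul_sum]
    refine sum_congr rfl fun i hi => ?_
    rw [← sum_range_sub_eq_psum hg0 hgn (mem_range.1 hi), sum_mul]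
  have hw20 : (fun l => w l ^ 2) 0 = 0 := by simp [hw0]
  have hw2n : ∀ j, n < j → (fun l => w l ^ 2) j = 0 := fun j hj => by simp [hwn j hj]
  have hX := hsum (fun l => w l ^ 2) hw20 hw2n (fun i => V (i + 1) ^ 2)
  have hP := hsum (fun l => w l ^ 2) hw20 hw2n (fun i => F (i + 1) ^ 2)
  set g₁ : ℕ → ℝ := fun j => if 1 ≤ j ∧ j ≤ n then (w (j + 1) - w j) ^ 2 else 0 with hg₁
  set g₂ : ℕ → ℝ := fun j => if 1 ≤ j ∧ j ≤ n then sqIncr w j else 0 with hg₂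
  have hG₁ := hsum g₁ (by simp [hg₁]) (fun j hj => by simp only [hg₁]; rw [if_neg (by omega)])
    (fun i => V i ^ 2)
  have hG₂ := hsum g₂ (by simp [hg₂]) (fun j hj => by simp only [hg₂]; rw [if_neg (by omega)])
    (fun i => V (i + 2) ^ 2)
  have e₁ : psum g₁ n = psum (fun l => (w (l + 1) - w l) ^ 2) n :=
    sum_congr rfl fun l hl => by
      have := mem_range.1 hl
      simp only [hg₁]; rw [if_pos ⟨by omega, by omega⟩]
  have e₂ : psum g₂ n = psum (sqIncr w) n :=
    sum_congr rfl fun l hl => by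
      have := mem_range.1 hl
      simp only [hg₂]; rw [if_pos ⟨by omega, by omega⟩]
  rw [e₁] at hG₁
  rw [e₂] at hG₂
  have hD₁ : 0 ≤ psum (fun l => (w (l + 1) - w l) ^ 2) n := psum_nonneg (fun _ => sq_nonneg _) n
  have hD₂ : 0 ≤ psum (sqIncr w) n := psum_nonneg (fun _ => sq_nonneg _) n
  have hV₁ : ∑ i ∈ range N, V i ^ 2 ≤ T := by
    simpa using sum_shift_down N (fun _ => 1) V hV0 (fun _ => zero_le_one)
  have hV₂ : ∑ i ∈ range N, V (i + 2) ^ 2 ≤ T := by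
    simpa using sum_shift_up N (fun _ => 1) V hVN (fun _ => zero_le_one)
  set p : ℕ × ℕ → ℝ := fun z =>
    if z.2 + 1 ≤ z.1 ∧ z.1 < z.2 + 1 + n then |w (z.1 + 1 - (z.2 + 1))| * F (z.2 + 1) else 0 with hp
  set q : ℕ × ℕ → ℝ := fun z => if z.2 + 1 ≤ z.1 ∧ z.1 < z.2 + 1 + n then
    α * |w (z.1 + 1 - z.2) - w (z.1 + 1 - (z.2 + 1))| * V z.2
      + β * |w (z.1 + 1 - (z.2 + 2)) - w (z.1 + 1 - (z.2 + 1))| * V (z.2 + 2) else 0 with hq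
  have hp2 : ∑ z ∈ range (N + n + 1) ×ˢ range N, p z ^ 2 ≤ s ^ 2 * (S * T) := by
    calc ∑ z ∈ range (N + n + 1) ×ˢ range N, p z ^ 2
        ≤ ∑ z ∈ range (N + n + 1) ×ˢ range N, w (z.1 + 1 - (z.2 + 1)) ^ 2 * F (z.2 + 1) ^ 2 := by
          refine sum_le_sum fun z _ => ?_
          simp only [hp]
          split_ifs
          · rw [mul_pow, sq_abs]
          · rw [zero_pow two_ne_zero]; positivity
      _ = S * ∑ i ∈ range N, F (i + 1) ^ 2 := hP
      _ ≤ S * (s ^ 2 * T) := mul_le_mul_of_nonneg_left hF hwpos.le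
      _ = s ^ 2 * (S * T) := by ring
  have hq2 : ∑ z ∈ range (N + n + 1) ×ˢ range N, q z ^ 2 ≤ M ^ 2 * (S * T) := by
    calc ∑ z ∈ range (N + n + 1) ×ˢ range N, q z ^ 2
        ≤ ∑ z ∈ range (N + n + 1) ×ˢ range N, (α * (g₁ (z.1 + 1 - (z.2 + 1)) * V z.2 ^ 2)
            + β * (g₂ (z.1 + 1 - (z.2 + 1)) * V (z.2 + 2) ^ 2)) := by
          refine sum_le_sum fun z _ => ?_
          simp only [hq]
          split_ifs with hz
          · obtain ⟨j, hj⟩ : ∃ j, z.1 = z.2 + 1 + j := ⟨z.1 - (z.2 + 1), by omega⟩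
            simp only [hg₁, hg₂, sqIncr]
            rw [if_pos (by omega), if_pos (by omega), hj,
              show z.2 + 1 + j + 1 - z.2 = j + 1 + 1 by omega,
              show z.2 + 1 + j + 1 - (z.2 + 1) = j + 1 by omega,
              show z.2 + 1 + j + 1 - (z.2 + 2) = j by omega, Nat.add_sub_cancel, mul_assoc,
              mul_assoc, abs_sub_comm (w j)]
            refine (sq_convex_le hα hβ hαβ).trans (le_of_eq ?_)
            rw [mul_pow, mul_pow, sq_abs, sq_abs]
          · have n1 : 0 ≤ g₁ (z.1 + 1 - (z.2 + 1)) := by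
              simp only [hg₁]; split_ifs <;> positivity
            have n2 : 0 ≤ g₂ (z.1 + 1 - (z.2 + 1)) := by
              simp only [hg₂, sqIncr]; split_ifs <;> positivity
            rw [zero_pow two_ne_zero]; positivity
      _ = α * (psum (fun l => (w (l + 1) - w l) ^ 2) n * ∑ i ∈ range N, V i ^ 2)
            + β * (psum (sqIncr w) n * ∑ i ∈ range N, V (i + 2) ^ 2) := by
          rw [sum_add_distrib, ← mul_sum, ← mul_sum, hG₁, hG₂]
      _ ≤ α * (psum (fun l => (w (l + 1) - w l) ^ 2) n * T) + β * (psum (sqIncr w) n * T) := by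
          gcongr
      _ = (α * psum (fun l => (w (l + 1) - w l) ^ 2) n + β * psum (sqIncr w) n) * T := by ring
      _ ≤ M ^ 2 * S * T := mul_le_mul_of_nonneg_right hw hVpos.le
      _ = M ^ 2 * (S * T) := by ring
  have htot := sum_add_sq_le _ p q hs hM (mul_pos hwpos hVpos).le hp2 hq2
  rw [← hX, sum_product, sum_product] at htot
  have hpos : 0 < ∑ k ∈ range (N + n + 1),
      ∑ i ∈ range N, w (k + 1 - (i + 1)) ^ 2 * V (i + 1) ^ 2 := by
    rw [← sum_product (range (N + n + 1)) (range N)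
      (fun z => w (z.1 + 1 - (z.2 + 1)) ^ 2 * V (z.2 + 1) ^ 2), hX]
    exact mul_pos hwpos hVpos
  obtain ⟨k, -, hk, hle⟩ := exists_le_of_sum_le _ _ _
    (fun k _ => sum_nonneg fun i _ => sq_nonneg _)
    (fun k _ => sum_nonneg fun i _ => by positivity) hpos htot
  refine ⟨k, fun i => w (k + 1 - i), fun i hi h => ?_, hk, ?_⟩
  · by_contra hcon
    apply h
    rcases Nat.lt_or_ge k i with h1 | h1
    · simp only [show k + 1 - i = 0 by omega, hw0]
    · exact hwn _ (by omega)
  · refine le_trans (le_of_eq (sum_congr rfl fun i _ => ?_)) hle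
    simp only [hp, hq]
    split_ifs
    · rfl
    · ring

theorem hasGoodTruncation {N n : ℕ} (hn : 1 ≤ n) {α β s : ℝ} (hα : 0 ≤ α) (hβ : 0 ≤ β)
    (hαβ : α + β = 1) (hs : 0 ≤ s) {F V : ℕ → ℝ} (hV0 : V 0 = 0) (hVN : V (N + 1) = 0)
    (hVpos : 0 < ∑ i ∈ range N, V (i + 1) ^ 2)
    (hF : ∑ i ∈ range N, F (i + 1) ^ 2 ≤ s ^ 2 * ∑ i ∈ range N, V (i + 1) ^ 2) :
    HasGoodTruncation N n α β (s + 2 * Real.sin (SpecIncl.theta (α * β) n / 2)) F V := by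
  obtain ⟨⟨hθl, hθu⟩, heq⟩ := theta_spec (c := α * β) (by positivity)
    (by nlinarith [sq_nonneg (α - β)]) hn
  set θ := SpecIncl.theta (α * β) n
  have hπ := Real.pi_pos
  have hθ0 : 0 < θ := lt_of_lt_of_le (by positivity) hθl
  have hθ3 : θ ≤ Real.pi / 3 :=
    hθu.trans (div_le_div_of_nonneg_left hπ.le (by norm_num)
      (by have : (1 : ℝ) ≤ n := by exact_mod_cast hn
          linarith))
  have hM0 : 0 ≤ Real.sin (θ / 2) :=
    Real.sin_nonneg_of_nonneg_of_le_pi (by linarith) (by linarith)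
  have hsin : 0 < Real.sin θ := Real.sin_pos_of_pos_of_lt_pi hθ0 (by linarith)
  have hcos : 2 - (2 * Real.sin (θ / 2)) ^ 2 = 2 * Real.cos θ := by
    have h := Real.cos_two_mul (θ / 2)
    have h' := Real.sin_sq_add_cos_sq (θ / 2)
    rw [show 2 * (θ / 2) = θ by ring] at h
    nlinarith
  set a : ℕ → ℝ := fun j => Real.sin (j * θ) - α * Real.sin (((j : ℝ) - 1) * θ) with ha
  have hrec : ∀ j, a (j + 2) = (2 - (2 * Real.sin (θ / 2)) ^ 2) * a (j + 1) - a j := by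
    intro j
    have key : ∀ t : ℝ, Real.sin (t + θ) = 2 * Real.cos θ * Real.sin t - Real.sin (t - θ) := by
      intro t; rw [Real.sin_add, Real.sin_sub]; ring
    have k1 := key (((j : ℝ) + 1) * θ)
    have k2 := key ((j : ℝ) * θ)
    rw [hcos]
    simp only [ha]
    push_cast
    rw [show ((j : ℝ) + 2) * θ = (j + 1) * θ + θ by ring, k1,
      show ((j : ℝ) + 2 - 1) * θ = j * θ + θ by ring, k2,
      show ((j : ℝ) + 1 - 1) * θ = j * θ by ring, show ((j : ℝ) + 1) * θ - θ = j * θ by ring,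
      show (j : ℝ) * θ - θ = (j - 1) * θ by ring]
    ring
  have ha1 : a 1 = Real.sin θ := by simp [ha]
  have ha0 : a 0 = α * Real.sin θ := by simp [ha]
  have haend : a (n + 1) = β * a n := by
    simp only [ha]; push_cast
    rw [show ((n : ℝ) + 1 - 1) * θ = n * θ by ring]
    linear_combination heq - Real.sin (n * θ) * hαβ
  set w : ℕ → ℝ := fun j => if 1 ≤ j ∧ j ≤ n then a j else 0 with hw
  have hw0 : w 0 = 0 := by simp [hw]
  have hwa : ∀ j, j < n → w (j + 1) = a (j + 1) := by
    intro j hj; simp only [hw]; rw [if_pos ⟨by omega, by omega⟩]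
  have hwn : ∀ j, n < j → w j = 0 := by
    intro j hj; simp only [hw]; rw [if_neg (by omega)]
  obtain ⟨p, rfl⟩ : ∃ p, n = p + 1 := ⟨n - 1, by omega⟩
  have hYeq := psum_sqIncr_eq hrec hw0 hwa (show p < p + 1 by omega)
  refine hasGoodTruncation_of_weights hα hβ hαβ hs (by positivity) hw0 hwn ?_ ?_ hV0 hVN hVpos hF
  · refine lt_of_lt_of_le ?_ (psum_mono (fun j => sq_nonneg (w j)) (show 1 ≤ p + 1 by omega))
    rw [psum, sum_range_one, hwa 0 (by omega), ha1]
    positivity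
  · have h1 : psum (fun l => (w (l + 1) - w l) ^ 2) (p + 1) + w 1 ^ 2 = psum (sqIncr w)
      (p + 1 + 1) := by
      unfold psum
      rw [sum_range_succ' _ (p + 1)]
      simp [sqIncr, hw0]
    rw [psum_succ (sqIncr w), show sqIncr w (p + 1 + 1) = (w (p + 1 + 1) - w (p + 1)) ^ 2 from rfl,
      hwn (p + 1 + 1) (by omega), hwa p (by omega),
      hwa 0 (by omega), ha1] at h1
    rw [show psum (fun l => (w (l + 1) - w l) ^ 2) (p + 1)
        = psum (sqIncr w) (p + 1) + a (p + 1) ^ 2 - Real.sin θ ^ 2 by linarith, hYeq, haend, ha1,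
            ha0]
    obtain rfl : α = 1 - β := by linarith
    exact le_of_eq (by ring)

section singularVectors

open SpecIncl

variable {ι κ : Type*} [Fintype ι] [Fintype κ] [DecidableEq κ]

theorem sval_le_of_norm_le {F : Matrix ι κ ℂ} {σ : ℝ} {x : EuclideanSpace ℂ κ} (hx : x ≠ 0)
    (h : ‖Matrix.toEuclideanLin F x‖ ≤ σ * ‖x‖) : sval F ≤ σ := by
  have hx0 : 0 < ‖x‖ := norm_pos_iff.2 hx
  have h1 : sval F ≤ ‖Matrix.toEuclideanLin F (((‖x‖⁻¹ : ℝ) : ℂ) • x)‖ := by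
    refine csInf_le ⟨0, ?_⟩ ⟨((‖x‖⁻¹ : ℝ) : ℂ) • x, ?_, rfl⟩
    · rintro y ⟨x, -, rfl⟩; exact norm_nonneg _
    · rw [norm_smul, Complex.norm_real, norm_inv, norm_norm, inv_mul_cancel₀ hx0.ne']
  refine h1.trans ?_
  rw [map_smul, norm_smul, Complex.norm_real, norm_inv, norm_norm, inv_mul_le_iff₀ hx0]
  linarith

theorem exists_norm_eq_sval [Nonempty κ] (F : Matrix ι κ ℂ) :
    ∃ x : EuclideanSpace ℂ κ, ‖x‖ = 1 ∧ ‖Matrix.toEuclideanLin F x‖ = sval F ∧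
      ∀ y : EuclideanSpace ℂ κ, ‖y‖ = 1 → sval F ≤ ‖Matrix.toEuclideanLin F y‖ := by
  obtain ⟨x, hx, hmin⟩ := (isCompact_sphere (0 : EuclideanSpace ℂ κ) 1).exists_isMinOn
    (NormedSpace.sphere_nonempty.2 zero_le_one)
    (f := fun x => ‖Matrix.toEuclideanLin F x‖)
    ((Matrix.toEuclideanLin F).continuous_of_finiteDimensional.norm.continuousOn)
  rw [mem_sphere_zero_iff_norm] at hx
  have h : IsLeast {y : ℝ | ∃ x : EuclideanSpace ℂ κ, ‖x‖ = 1 ∧ y = ‖Matrix.toEuclideanLin F x‖}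
      ‖Matrix.toEuclideanLin F x‖ :=
    ⟨⟨x, hx, rfl⟩, by rintro y ⟨z, hz, rfl⟩; exact hmin (mem_sphere_zero_iff_norm.2 hz)⟩
  refine ⟨x, hx, h.csInf_eq.symm, fun y hy => ?_⟩
  rw [sval, h.csInf_eq]
  exact h.2 ⟨y, hy, rfl⟩

theorem sval_nonneg (F : Matrix ι κ ℂ) : 0 ≤ sval F := by
  apply Real.sInf_nonneg
  rintro y ⟨x, -, rfl⟩
  exact norm_nonneg _

theorem norm_toEuclideanLin_le (F : Matrix ι κ ℂ) (x : EuclideanSpace ℂ κ) :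
    ‖Matrix.toEuclideanLin F x‖ ≤ opNorm F * ‖x‖ := by
  rcases eq_or_ne x 0 with rfl | hx
  · simp
  have hx0 : 0 < ‖x‖ := norm_pos_iff.2 hx
  have hb : BddAbove {y : ℝ | ∃ x : EuclideanSpace ℂ κ, ‖x‖ = 1 ∧
      y = ‖Matrix.toEuclideanLin F x‖} := by
    refine ⟨‖LinearMap.toContinuousLinearMap (Matrix.toEuclideanLin F)‖, ?_⟩
    rintro y ⟨z, hz, rfl⟩
    simpa [hz] using (LinearMap.toContinuousLinearMap (Matrix.toEuclideanLin F)).le_opNorm z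
  have := le_csSup hb ⟨((‖x‖⁻¹ : ℝ) : ℂ) • x,
    by rw [norm_smul, Complex.norm_real, norm_inv, norm_norm, inv_mul_cancel₀ hx0.ne'], rfl⟩
  rw [map_smul, norm_smul, Complex.norm_real, norm_inv, norm_norm, inv_mul_le_iff₀ hx0] at this
  rw [opNorm]; linarith

theorem opNorm_nonneg (F : Matrix ι κ ℂ) : 0 ≤ opNorm F := by
  apply Real.sSup_nonneg
  rintro y ⟨x, -, rfl⟩
  exact norm_nonneg _

/-- A pair of singular vectors for the smallest singular value (the left one may vanish if that
singular value is zero). -/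
theorem exists_singular_pair [DecidableEq ι] [Nonempty ι] (F : Matrix ι ι ℂ) :
    ∃ u v : EuclideanSpace ℂ ι, ‖v‖ = 1 ∧ Matrix.toEuclideanLin F v = (sval F : ℂ) • u ∧
      ∀ w, inner ℂ u (Matrix.toEuclideanLin F w) = (sval F : ℂ) * inner ℂ v w := by
  obtain ⟨v, hv, hvs, hmin⟩ := exists_norm_eq_sval F
  set T := LinearMap.toContinuousLinearMap (Matrix.toEuclideanLin F) with hT
  have hTapp : ∀ x, T x = Matrix.toEuclideanLin F x := fun _ => rfl
  have hsa : IsSelfAdjoint (T.adjoint ∘L T) := (ContinuousLinearMap.isPositive_adjoint_comp_self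
      T).isSelfAdjoint
  have hre : ∀ x, (T.adjoint ∘L T).reApplyInnerSelf x = ‖T x‖ ^ 2 := by
    intro x
    rw [ContinuousLinearMap.reApplyInnerSelf_apply, ContinuousLinearMap.comp_apply,
      ContinuousLinearMap.adjoint_inner_left, inner_self_eq_norm_sq]
  have hext : IsLocalExtrOn (T.adjoint ∘L T).reApplyInnerSelf
      (Metric.sphere (0 : EuclideanSpace ℂ ι) ‖v‖) v := by
    refine Or.inl (IsMinOn.localize fun y hy => ?_)
    rw [hv, mem_sphere_zero_iff_norm] at hy
    simp only [Set.mem_ofPred_eq, hre]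
    have := hmin y hy
    rw [← hvs] at this
    exact pow_le_pow_left₀ (norm_nonneg _) this 2
  have heig := hsa.eq_smul_self_of_isLocalExtrOn hext
  have hray : (T.adjoint ∘L T).rayleighQuotient v = sval F ^ 2 := by
    rw [ContinuousLinearMap.rayleighQuotient, hre, hv, hTapp, hvs]; simp
  rw [hray, ContinuousLinearMap.comp_apply] at heig
  have hadj : ∀ w, inner ℂ (T v) (T w) = ((sval F ^ 2 : ℝ) : ℂ) * inner ℂ v w := by
    intro w
    rw [← ContinuousLinearMap.adjoint_inner_left, heig, inner_smul_left]
    simp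
  rcases (sval_nonneg F).eq_or_lt with h0 | h0
  · refine ⟨0, v, hv, ?_, fun w => ?_⟩
    · rw [smul_zero, ← norm_eq_zero, hvs, h0]
    · rw [← h0]; simp
  · have hne : (sval F : ℂ) ≠ 0 := by exact_mod_cast h0.ne'
    refine ⟨(sval F : ℂ)⁻¹ • T v, v, hv, ?_, fun w => ?_⟩
    · rw [smul_inv_smul₀ hne, hTapp]
    · rw [inner_smul_left, ← hTapp, hadj]
      simp only [map_inv₀, Complex.conj_ofReal, Complex.ofReal_pow]
      field_simp

end singularVectors

section levels

variable {ι : Type*} [Fintype ι] [DecidableEq ι]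

/-- The orthogonal projection onto the coordinates of level `i`. -/
def levelProj (g : ι → ℕ) (i : ℕ) : EuclideanSpace ℂ ι →ₗ[ℂ] EuclideanSpace ℂ ι where
  toFun x := WithLp.toLp 2 fun q => if g q = i then x q else 0
  map_add' x y := by
    ext q
    by_cases h : g q = i <;> simp [h]
  map_smul' c x := by
    ext q
    by_cases h : g q = i <;> simp [h]

/-- Multiplication of the coordinates of level `i` by `φ i`. -/
def levelScale (g : ι → ℕ) (φ : ℕ → ℝ) (x : EuclideanSpace ℂ ι) : EuclideanSpace ℂ ι :=
  WithLp.toLp 2 fun q => (φ (g q) : ℂ) * x q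

omit [Fintype ι] [DecidableEq ι] in
theorem levelProj_apply (g : ι → ℕ) (i : ℕ) (x : EuclideanSpace ℂ ι) (q : ι) :
    levelProj g i x q = if g q = i then x q else 0 := rfl

omit [Fintype ι] [DecidableEq ι] in
theorem levelScale_apply (g : ι → ℕ) (φ : ℕ → ℝ) (x : EuclideanSpace ℂ ι) (q : ι) :
    levelScale g φ x q = (φ (g q) : ℂ) * x q := rfl

theorem toEuclideanLin_apply_apply (F : Matrix ι ι ℂ) (x : EuclideanSpace ℂ ι) (p : ι) :
    Matrix.toEuclideanLin F x p = ∑ q, F p q * x q := rfl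

omit [DecidableEq ι] in
theorem inner_levelProj (g : ι → ℕ) (i : ℕ) (x y : EuclideanSpace ℂ ι) :
    inner ℂ (levelProj g i x) y = inner ℂ x (levelProj g i y) := by
  rw [PiLp.inner_apply, PiLp.inner_apply]
  refine sum_congr rfl fun q _ => ?_
  rw [levelProj_apply, levelProj_apply]
  split_ifs <;> simp

omit [Fintype ι] [DecidableEq ι] in
theorem levelProj_levelProj (g : ι → ℕ) (i : ℕ) (x : EuclideanSpace ℂ ι) :
    levelProj g i (levelProj g i x) = levelProj g i x := by
  ext q
  simp only [levelProj_apply]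
  split_ifs <;> rfl

omit [Fintype ι] [DecidableEq ι] in
theorem levelProj_eq_zero {g : ι → ℕ} {i : ℕ} (h : ∀ q, g q ≠ i) (x : EuclideanSpace ℂ ι) :
    levelProj g i x = 0 := by
  ext q
  simp [levelProj_apply, h q]

omit [DecidableEq ι] in
theorem sum_norm_levelProj_sq {g : ι → ℕ} {N : ℕ} (hg : ∀ q, 1 ≤ g q ∧ g q ≤ N) (Q : ℕ → Prop)
    [DecidablePred Q] (x : EuclideanSpace ℂ ι) :
    ∑ i ∈ range N, (if Q (i + 1) then ‖levelProj g (i + 1) x‖ ^ 2 else 0)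
      = ∑ q, if Q (g q) then ‖x q‖ ^ 2 else 0 := by
  have h : ∀ i, (if Q (i + 1) then ‖levelProj g (i + 1) x‖ ^ 2 else 0)
      = ∑ q, if g q = i + 1 then (if Q (g q) then ‖x q‖ ^ 2 else 0) else 0 := by
    intro i
    rw [EuclideanSpace.norm_sq_eq]
    split_ifs with hQ
    · refine sum_congr rfl fun q _ => ?_
      rw [levelProj_apply]
      by_cases hq : g q = i + 1
      · simp [hq, hQ]
      · simp [hq]
    · refine (sum_eq_zero fun q _ => ?_).symm
      by_cases hq : g q = i + 1
      · simp [hq, hQ]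
      · simp [hq]
  simp only [h]
  rw [sum_comm]
  refine sum_congr rfl fun q _ => ?_
  rw [sum_eq_single (g q - 1)]
  · rw [if_pos (by have := (hg q).1; omega)]
  · intro i _ hi
    rw [if_neg (by omega)]
  · intro hq
    exact absurd (mem_range.2 (by have := hg q; omega)) hq

omit [DecidableEq ι] in
theorem sum_norm_levelProj_sq' {g : ι → ℕ} {N : ℕ} (hg : ∀ q, 1 ≤ g q ∧ g q ≤ N)
    (x : EuclideanSpace ℂ ι) : ∑ i ∈ range N, ‖levelProj g (i + 1) x‖ ^ 2 = ‖x‖ ^ 2 := by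
  simpa [EuclideanSpace.norm_sq_eq] using sum_norm_levelProj_sq hg (fun _ => True) x

omit [DecidableEq ι] in
theorem norm_levelProj_levelScale_sq (g : ι → ℕ) (φ : ℕ → ℝ) (i : ℕ) (x : EuclideanSpace ℂ ι) :
    ‖levelProj g i (levelScale g φ x)‖ ^ 2 = φ i ^ 2 * ‖levelProj g i x‖ ^ 2 := by
  have : levelProj g i (levelScale g φ x) = (φ i : ℂ) • levelProj g i x := by
    ext q
    simp only [PiLp.smul_apply, levelProj_apply, levelScale_apply, smul_eq_mul]
    split_ifs with h
    · rw [h]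
    · simp
  rw [this, norm_smul, mul_pow, Complex.norm_real, Real.norm_eq_abs, sq_abs]

/-- Block tridiagonality with respect to the levels `g`. -/
def IsLevelTridiagonal (g : ι → ℕ) (F : Matrix ι ι ℂ) : Prop :=
  ∀ p q, F p q ≠ 0 → g p ≤ g q + 1 ∧ g q ≤ g p + 1

variable {g : ι → ℕ} {F : Matrix ι ι ℂ}

theorem IsLevelTridiagonal.levelProj_levelScale (hF : IsLevelTridiagonal g F) (φ : ℕ → ℝ)
    (x : EuclideanSpace ℂ ι) (l : ℕ) :
    levelProj g (l + 1) (Matrix.toEuclideanLin F (levelScale g φ x))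
      = (φ (l + 1) : ℂ) • levelProj g (l + 1) (Matrix.toEuclideanLin F x)
        + (((φ l - φ (l + 1) : ℝ) : ℂ) •
            levelProj g (l + 1) (Matrix.toEuclideanLin F (levelProj g l x))
          + ((φ (l + 2) - φ (l + 1) : ℝ) : ℂ) •
            levelProj g (l + 1) (Matrix.toEuclideanLin F (levelProj g (l + 2) x))) := by
  ext p
  simp only [PiLp.add_apply, PiLp.smul_apply, levelProj_apply, toEuclideanLin_apply_apply,
    levelScale_apply, smul_eq_mul]
  split_ifs with hp
  · rw [mul_sum, mul_sum, mul_sum, ← sum_add_distrib, ← sum_add_distrib]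
    refine sum_congr rfl fun q _ => ?_
    by_cases h0 : F p q = 0
    · simp [h0]
    have := hF p q h0
    obtain h | h | h : g q = l ∨ g q = l + 1 ∨ g q = l + 2 := by omega
    · simp only [h]; push_cast; simp; ring
    · simp only [h]; push_cast; simp; ring
    · simp only [h]; push_cast; simp; ring
  · simp

theorem IsLevelTridiagonal.levelProj_row (hF : IsLevelTridiagonal g F)
    (x : EuclideanSpace ℂ ι) (l : ℕ) :
    levelProj g (l + 1) (Matrix.toEuclideanLin F x)
      = levelProj g (l + 1) (Matrix.toEuclideanLin F (levelProj g (l + 1) x))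
        + levelProj g (l + 1) (Matrix.toEuclideanLin F (levelProj g l x))
        + levelProj g (l + 1) (Matrix.toEuclideanLin F (levelProj g (l + 2) x)) := by
  ext p
  simp only [PiLp.add_apply, levelProj_apply, toEuclideanLin_apply_apply]
  split_ifs with hp
  · rw [← sum_add_distrib, ← sum_add_distrib]
    refine sum_congr rfl fun q _ => ?_
    by_cases h0 : F p q = 0
    · simp [h0]
    have := hF p q h0
    obtain h | h | h : g q = l ∨ g q = l + 1 ∨ g q = l + 2 := by omega
    all_goals simp [h]
  · simp

theorem IsLevelTridiagonal.levelProj_col (hF : IsLevelTridiagonal g F)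
    (x : EuclideanSpace ℂ ι) (l : ℕ) :
    Matrix.toEuclideanLin F (levelProj g (l + 1) x)
      = levelProj g (l + 1) (Matrix.toEuclideanLin F (levelProj g (l + 1) x))
        + levelProj g l (Matrix.toEuclideanLin F (levelProj g (l + 1) x))
        + levelProj g (l + 2) (Matrix.toEuclideanLin F (levelProj g (l + 1) x)) := by
  ext p
  have h0 : ¬(g p = l ∨ g p = l + 1 ∨ g p = l + 2) →
      ∑ q, F p q * (levelProj g (l + 1) x) q = 0 := by
    intro h
    refine sum_eq_zero fun q _ => ?_
    rw [levelProj_apply]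
    split_ifs with hq
    · by_cases h0 : F p q = 0
      · simp [h0]
      · have := hF p q h0
        omega
    · simp
  simp only [PiLp.add_apply, levelProj_apply g _ (Matrix.toEuclideanLin F _),
    toEuclideanLin_apply_apply]
  by_cases h : g p = l ∨ g p = l + 1 ∨ g p = l + 2
  · obtain h | h | h := h <;> simp [h]
  · rw [h0 h]; simp

/-- The compression of `F` to the levels `lo + 1, …, lo + len` has an approximate null vector. -/
def HasWindowVector (g : ι → ℕ) (F : Matrix ι ι ℂ) (lo len : ℕ) (σ : ℝ) : Prop :=
  ∃ y : EuclideanSpace ℂ ι, y ≠ 0 ∧ (∀ q, y q ≠ 0 → lo < g q ∧ g q ≤ lo + len) ∧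
    ∑ q, (if lo < g q ∧ g q ≤ lo + len then ‖Matrix.toEuclideanLin F y q‖ ^ 2 else 0)
      ≤ σ ^ 2 * ‖y‖ ^ 2

theorem hasWindowVector_of_cutoff {N : ℕ} (hg : ∀ q, 1 ≤ g q ∧ g q ≤ N) {φ : ℕ → ℝ}
    {lo len : ℕ} {σ : ℝ} (x : EuclideanSpace ℂ ι)
    (hφ : ∀ i, 1 ≤ i → i ≤ N → φ i ≠ 0 → lo < i ∧ i ≤ lo + len)
    (hpos : 0 < ∑ i ∈ range N, φ (i + 1) ^ 2 * ‖levelProj g (i + 1) x‖ ^ 2)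
    (h : ∑ i ∈ range N, (if lo < i + 1 ∧ i + 1 ≤ lo + len then
        ‖levelProj g (i + 1) (Matrix.toEuclideanLin F (levelScale g φ x))‖ ^ 2 else 0)
      ≤ σ ^ 2 * ∑ i ∈ range N, φ (i + 1) ^ 2 * ‖levelProj g (i + 1) x‖ ^ 2) :
    HasWindowVector g F lo len σ := by
  have e : ∑ i ∈ range N, φ (i + 1) ^ 2 * ‖levelProj g (i + 1) x‖ ^ 2 = ‖levelScale g φ x‖ ^ 2 := by
    rw [← sum_norm_levelProj_sq' hg]
    exact sum_congr rfl fun i _ => (norm_levelProj_levelScale_sq g φ _ x).symm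
  rw [e] at hpos h
  rw [sum_norm_levelProj_sq hg (fun i => lo < i ∧ i ≤ lo + len)] at h
  refine ⟨_, fun h0 => ?_, fun q hq => ?_, h⟩
  · rw [h0] at hpos; simp at hpos
  · refine hφ _ (hg q).1 (hg q).2 fun h0 => hq ?_
    rw [levelScale_apply, h0]; simp

end levels

section windows

variable {ι : Type*} [Fintype ι] [DecidableEq ι] {g : ι → ℕ} {F : Matrix ι ι ℂ} {N : ℕ}
  {rl ru : ℝ}

omit [DecidableEq ι] in
theorem inner_levelProj_levelProj (g : ι → ℕ) (i : ℕ) (x y : EuclideanSpace ℂ ι) :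
    inner ℂ (levelProj g i x) (levelProj g i y) = inner ℂ (levelProj g i x) y := by
  rw [← inner_levelProj, levelProj_levelProj]

omit [DecidableEq ι] in
theorem norm_smul_add_smul_add_smul_sq_le (u X Y : EuclideanSpace ℂ ι) (c a b : ℝ) {A B : ℝ}
    (hA : ‖X‖ ≤ A) (hB : ‖Y‖ ≤ B) :
    ‖(c : ℂ) • u + ((a : ℂ) • X + (b : ℂ) • Y)‖ ^ 2
      ≤ c ^ 2 * ‖u‖ ^ 2 + 2 * c * (a * RCLike.re (inner ℂ u X) + b * RCLike.re (inner ℂ u Y))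
        + (|a| * A + |b| * B) ^ 2 := by
  have h : ‖(a : ℂ) • X + (b : ℂ) • Y‖ ≤ |a| * A + |b| * B := by
    refine (norm_add_le _ _).trans ?_
    rw [norm_smul, norm_smul, Complex.norm_real, Complex.norm_real, Real.norm_eq_abs,
      Real.norm_eq_abs]
    gcongr
  rw [norm_add_sq (𝕜 := ℂ)]
  have e : RCLike.re (inner ℂ ((c : ℂ) • u) ((a : ℂ) • X + (b : ℂ) • Y))
      = c * (a * RCLike.re (inner ℂ u X) + b * RCLike.re (inner ℂ u Y)) := by
    simp only [inner_smul_left, inner_add_right, inner_smul_right, Complex.conj_ofReal]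
    simp
    ring
  rw [e, norm_smul, Complex.norm_real, Real.norm_eq_abs, mul_pow, sq_abs]
  have := pow_le_pow_left₀ (norm_nonneg _) h 2
  linarith

theorem exists_hasWindowVector_of_cutoff [Nonempty ι] (hg : ∀ q, 1 ≤ g q ∧ g q ≤ N)
    (hF : IsLevelTridiagonal g F) (hrl : 0 ≤ rl) (hru : 0 ≤ ru) (hr : 0 < rl + ru)
    (hL : ∀ i x, ‖levelProj g (i + 1) (Matrix.toEuclideanLin F (levelProj g i x))‖
      ≤ rl * ‖levelProj g i x‖)
    (hU : ∀ i x, ‖levelProj g i (Matrix.toEuclideanLin F (levelProj g (i + 1) x))‖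
      ≤ ru * ‖levelProj g (i + 1) x‖)
    {p : ℕ} (hp : 1 ≤ p) (hpN : p + 2 < N) :
    ∃ k, k + (p + 2) ≤ N ∧ HasWindowVector g F k (p + 2) (SpecIncl.sval F
      + 2 * (rl + ru) * Real.sin (SpecIncl.theta (rl * ru / (rl + ru) ^ 2) p / 2)) := by
  obtain ⟨u, v, hv, hTv, huT⟩ := exists_singular_pair F
  have hs := sval_nonneg F
  set s := SpecIncl.sval F
  set r := rl + ru with hrdef
  set T := Matrix.toEuclideanLin F
  have hzero : ∀ i, (i = 0 ∨ N < i) → ∀ x : EuclideanSpace ℂ ι, levelProj g i x = 0 :=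
    fun i hi x => levelProj_eq_zero (fun q h => by have := hg q; omega) x
  have hcut : HasGoodCutoff N (p + 2) (s / r) (rl / r) (ru / r)
      (2 * Real.sin (SpecIncl.theta (rl / r * (ru / r)) p / 2))
      (fun i => ‖levelProj g i u‖) (fun i => ‖levelProj g i v‖)
      (fun i => RCLike.re (inner ℂ (levelProj g i u) (T (levelProj g (i - 1) v))) / r)
      (fun i => RCLike.re (inner ℂ (levelProj g i u) (T (levelProj g (i + 1) v))) / r) := by
    refine hasGoodCutoff hp hpN (by positivity) (by positivity) (by rw [← add_div, ← hrdef,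
      div_self hr.ne']) (by positivity) ?_ ?_ ?_ ?_ ?_ ?_ ?_ ?_
    · simp [hzero 0]
    · simp [hzero 0]
    · simp [hzero (N + 1)]
    · simp [hzero (N + 1)]
    · rw [sum_norm_levelProj_sq' hg, hv]; norm_num
    · intro i _
      simp only [Nat.add_sub_cancel]
      rw [abs_div, abs_of_pos hr, div_mul_eq_mul_div]
      gcongr
      rw [← inner_levelProj_levelProj]
      refine (RCLike.abs_re_le_norm _).trans ((norm_inner_le_norm _ _).trans ?_)
      calc _ ≤ ‖levelProj g (i + 1) u‖ * (rl * ‖levelProj g i v‖) := by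
            gcongr; exact hL i v
        _ = _ := by ring
    · intro i _
      rw [abs_div, abs_of_pos hr, div_mul_eq_mul_div]
      gcongr
      rw [← inner_levelProj_levelProj]
      refine (RCLike.abs_re_le_norm _).trans ((norm_inner_le_norm _ _).trans ?_)
      calc _ ≤ ‖levelProj g i u‖ * (ru * ‖levelProj g (i + 1) v‖) := by
            gcongr; exact hU i v
        _ = _ := by ring
    · intro i _
      have hre : ∀ z : ℂ, RCLike.re ((s : ℂ) * z) = s * RCLike.re z := fun z => by simp
      have h1 : s * ‖levelProj g (i + 1) u‖ ^ 2
          = RCLike.re (inner ℂ (levelProj g (i + 1) u) (T v)) := by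
        rw [hTv, inner_smul_right, ← inner_levelProj_levelProj, hre, inner_self_eq_norm_sq]
      have h2 : s * ‖levelProj g (i + 1) v‖ ^ 2
          = RCLike.re (inner ℂ u (T (levelProj g (i + 1) v))) := by
        rw [huT, ← levelProj_levelProj, ← inner_levelProj, levelProj_levelProj, hre,
          inner_self_eq_norm_sq]
      rw [← inner_levelProj_levelProj, hF.levelProj_row v i] at h1
      rw [hF.levelProj_col v i] at h2
      simp only [inner_add_right, map_add, ← inner_levelProj, levelProj_levelProj] at h1 h2
      simp only [Nat.add_sub_cancel, show i + 2 - 1 = i + 1 by omega, show i + 1 + 1 = i + 2 from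
          rfl]
      field_simp
      linarith
  obtain ⟨k, φ, hk, hφ, hpos, hle⟩ := hcut
  refine ⟨k, hk, hasWindowVector_of_cutoff hg v hφ hpos ?_⟩
  have hrow : ∀ i, ‖levelProj g (i + 1) (T (levelScale g φ v))‖ ^ 2 ≤ r ^ 2 *
      rowFunctional (s / r) (rl / r) (ru / r)
        (fun i => ‖levelProj g i u‖) (fun i => ‖levelProj g i v‖)
        (fun i => RCLike.re (inner ℂ (levelProj g i u) (T (levelProj g (i - 1) v))) / r)
        (fun i => RCLike.re (inner ℂ (levelProj g i u) (T (levelProj g (i + 1) v))) / r) φ i := by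
    intro i
    rw [hF.levelProj_levelScale, hTv, map_smul, smul_smul, ← Complex.ofReal_mul]
    refine (norm_smul_add_smul_add_smul_sq_le _ _ _ _ _ _ (hL i v) (hU (i + 1) v)).trans
      (le_of_eq ?_)
    rw [rowFunctional, inner_levelProj_levelProj, inner_levelProj_levelProj]
    simp only [Nat.add_sub_cancel, show i + 1 + 1 = i + 2 from rfl]
    field_simp
  have e : rl / r * (ru / r) = rl * ru / r ^ 2 := by field_simp
  rw [e] at hle
  calc _ ≤ ∑ i ∈ range N, r ^ 2 * (if k < i + 1 ∧ i + 1 ≤ k + (p + 2) then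
      rowFunctional (s / r) (rl / r) (ru / r)
        (fun i => ‖levelProj g i u‖) (fun i => ‖levelProj g i v‖)
        (fun i => RCLike.re (inner ℂ (levelProj g i u) (T (levelProj g (i - 1) v))) / r)
        (fun i => RCLike.re (inner ℂ (levelProj g i u) (T (levelProj g (i + 1) v))) / r) φ i
        else 0) := by
        refine sum_le_sum fun i _ => ?_
        split_ifs
        · exact hrow i
        · simp
    _ ≤ _ := by
        rw [← mul_sum]
        refine (mul_le_mul_of_nonneg_left hle (sq_nonneg r)).trans (le_of_eq ?_)
        rw [← mul_assoc, ← mul_pow, mul_add, mul_div_cancel₀ _ hr.ne']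
        congr 2
        ring

end windows

section truncations

variable {ι : Type*} [Fintype ι] [DecidableEq ι] {g : ι → ℕ} {F : Matrix ι ι ℂ} {N : ℕ}
  {rl ru : ℝ}

theorem exists_hasWindowVector_of_truncation [Nonempty ι] (hg : ∀ q, 1 ≤ g q ∧ g q ≤ N)
    (hF : IsLevelTridiagonal g F) (hrl : 0 ≤ rl) (hru : 0 ≤ ru) (hr : 0 < rl + ru)
    (hL : ∀ i x, ‖levelProj g (i + 1) (Matrix.toEuclideanLin F (levelProj g i x))‖
      ≤ rl * ‖levelProj g i x‖)
    (hU : ∀ i x, ‖levelProj g i (Matrix.toEuclideanLin F (levelProj g (i + 1) x))‖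
      ≤ ru * ‖levelProj g (i + 1) x‖)
    {n : ℕ} (hn : 1 ≤ n) (hnN : n ≤ N) :
    ∃ lo len, lo + len ≤ N ∧ 1 ≤ len ∧ (len = n ∨ len < n ∧ (lo = 0 ∨ lo + len = N)) ∧
      HasWindowVector g F lo len (SpecIncl.sval F
        + 2 * (rl + ru) * Real.sin (SpecIncl.theta (rl * ru / (rl + ru) ^ 2) n / 2)) := by
  obtain ⟨v, hv, hTv, -⟩ := exists_norm_eq_sval F
  have hs := sval_nonneg F
  set s := SpecIncl.sval F
  set r := rl + ru with hrdef
  set T := Matrix.toEuclideanLin F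
  have hzero : ∀ i, (i = 0 ∨ N < i) → ∀ x : EuclideanSpace ℂ ι, levelProj g i x = 0 :=
    fun i hi x => levelProj_eq_zero (fun q h => by have := hg q; omega) x
  obtain ⟨k, φ, hφ, hpos, hle⟩ : HasGoodTruncation N n (rl / r) (ru / r)
      (s / r + 2 * Real.sin (SpecIncl.theta (rl / r * (ru / r)) n / 2))
      (fun i => ‖levelProj g i (T v)‖ / r) (fun i => ‖levelProj g i v‖) := by
    refine hasGoodTruncation hn (by positivity) (by positivity) (by rw [← add_div, ← hrdef,
      div_self hr.ne']) (by positivity) ?_ ?_ ?_ ?_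
    · simp [hzero 0]
    · simp [hzero (N + 1)]
    · rw [sum_norm_levelProj_sq' hg, hv]; norm_num
    · simp only [div_pow, ← sum_div]
      rw [sum_norm_levelProj_sq' hg, sum_norm_levelProj_sq' hg, hTv, hv]
      simp
  obtain ⟨i, hi, hi0⟩ : ∃ i ∈ range N, φ (i + 1) ≠ 0 := by
    by_contra! h
    refine hpos.ne' (sum_eq_zero fun i hi => ?_)
    rw [h i hi]; simp
  have hik := hφ (i + 1) (by omega) hi0
  rw [mem_range] at hi
  refine ⟨k - n, min k N - (k - n), by omega, by omega, by omega,
    hasWindowVector_of_cutoff hg v (fun j hj hjN hj0 => ?_) hpos ?_⟩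
  · have := hφ j hj hj0
    omega
  have hrow : ∀ i, ‖levelProj g (i + 1) (T (levelScale g φ v))‖ ^ 2 ≤ r ^ 2 *
      (|φ (i + 1)| * (‖levelProj g (i + 1) (T v)‖ / r)
        + (rl / r * |φ i - φ (i + 1)| * ‖levelProj g i v‖
          + ru / r * |φ (i + 2) - φ (i + 1)| * ‖levelProj g (i + 2) v‖)) ^ 2 := by
    intro i
    rw [← mul_pow]
    refine pow_le_pow_left₀ (norm_nonneg _) ?_ 2
    rw [hF.levelProj_levelScale]
    calc _ ≤ |φ (i + 1)| * ‖levelProj g (i + 1) (T v)‖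
        + (|φ i - φ (i + 1)| * (rl * ‖levelProj g i v‖)
          + |φ (i + 2) - φ (i + 1)| * (ru * ‖levelProj g (i + 2) v‖)) := by
          refine (norm_add_le _ _).trans (add_le_add ?_ ((norm_add_le _ _).trans
            (add_le_add ?_ ?_)))
          · rw [norm_smul, Complex.norm_real, Real.norm_eq_abs]
          · rw [norm_smul, Complex.norm_real, Real.norm_eq_abs]
            exact mul_le_mul_of_nonneg_left (hL i v) (abs_nonneg _)
          · rw [norm_smul, Complex.norm_real, Real.norm_eq_abs]
            exact mul_le_mul_of_nonneg_left (hU (i + 1) v) (abs_nonneg _)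
      _ = _ := by field_simp
  have e : rl / r * (ru / r) = rl * ru / r ^ 2 := by field_simp
  rw [e] at hle
  calc _ ≤ ∑ i ∈ range N, r ^ 2 * (if i + 1 ≤ k ∧ k < i + 1 + n then
        (|φ (i + 1)| * (‖levelProj g (i + 1) (T v)‖ / r)
          + (rl / r * |φ i - φ (i + 1)| * ‖levelProj g i v‖
            + ru / r * |φ (i + 2) - φ (i + 1)| * ‖levelProj g (i + 2) v‖)) ^ 2
        else 0) := by
        refine sum_le_sum fun i _ => ?_
        split_ifs
        · exact hrow i
        · omega
        · positivity
        · simp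
    _ ≤ _ := by
        rw [← mul_sum]
        refine (mul_le_mul_of_nonneg_left hle (sq_nonneg r)).trans (le_of_eq ?_)
        rw [← mul_assoc, ← mul_pow, mul_add, mul_div_cancel₀ _ hr.ne']
        congr 2
        ring

theorem exists_hasWindowVector_of_diagonal [Nonempty ι] (hg : ∀ q, 1 ≤ g q ∧ g q ≤ N)
    (hF : IsLevelTridiagonal g F)
    (hL : ∀ i x, levelProj g (i + 1) (Matrix.toEuclideanLin F (levelProj g i x)) = 0)
    (hU : ∀ i x, levelProj g i (Matrix.toEuclideanLin F (levelProj g (i + 1) x)) = 0)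
    {n : ℕ} (hn : 1 ≤ n) (hnN : n ≤ N) :
    ∃ k, k + n ≤ N ∧ HasWindowVector g F k n (SpecIncl.sval F) := by
  obtain ⟨v, hv, hTv, -⟩ := exists_norm_eq_sval F
  set s := SpecIncl.sval F
  set T := Matrix.toEuclideanLin F
  obtain ⟨i, hi, hpos, hle⟩ := exists_le_of_sum_le (range N)
    (fun i => ‖levelProj g (i + 1) (T v)‖ ^ 2) (fun i => ‖levelProj g (i + 1) v‖ ^ 2)
    (c := s ^ 2) (fun _ _ => sq_nonneg _) (fun _ _ => sq_nonneg _)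
    (by rw [sum_norm_levelProj_sq' hg, hv]; norm_num)
    (by rw [sum_norm_levelProj_sq' hg, sum_norm_levelProj_sq' hg, hTv, hv]; simp)
  rw [mem_range] at hi
  have hsum : ∀ G : ℕ → ℝ, ∑ j ∈ range N, (if j = i then 1 else 0 : ℝ) ^ 2 * G j = G i := by
    intro G
    simp [hi]
  refine ⟨min i (N - n), by omega, hasWindowVector_of_cutoff hg
    (φ := fun j => if j = i + 1 then 1 else 0) v (fun j hj hjN hj0 => ?_) ?_ ?_⟩
  · simp only [ne_eq, ite_eq_right_iff, one_ne_zero, imp_false, not_not] at hj0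
    omega
  · simp only [Nat.add_right_cancel_iff]
    rwa [hsum fun j => ‖levelProj g (j + 1) v‖ ^ 2]
  · simp only [Nat.add_right_cancel_iff]
    rw [hsum fun j => ‖levelProj g (j + 1) v‖ ^ 2]
    refine le_trans ?_ hle
    rw [← hsum fun j => ‖levelProj g (j + 1) (T v)‖ ^ 2]
    refine sum_le_sum fun j _ => ?_
    rw [hF.levelProj_levelScale, hL, hU (j + 1)]
    by_cases h : j = i
    · simp only [h, if_true, smul_zero, add_zero]
      split_ifs
      · simp [T]
      · positivity
    · simp [h]

end truncations

section submatrix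

theorem sval_submatrix_le {ι κ : Type*} [Fintype ι] [DecidableEq ι] [Fintype κ] [DecidableEq κ]
    (F : Matrix ι ι ℂ) {e : κ → ι} (he : Function.Injective e) {y : EuclideanSpace ℂ ι}
    (hy : y ≠ 0) (hsupp : ∀ q, q ∉ Set.range e → y q = 0) {σ : ℝ} (hσ : 0 ≤ σ)
    (h : ∑ p, ‖Matrix.toEuclideanLin F y (e p)‖ ^ 2 ≤ σ ^ 2 * ‖y‖ ^ 2) :
    SpecIncl.sval (F.submatrix e e) ≤ σ := by
  set x : EuclideanSpace ℂ κ := WithLp.toLp 2 fun p => y (e p)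
  have hx : ‖x‖ ^ 2 = ‖y‖ ^ 2 := by
    rw [EuclideanSpace.norm_sq_eq, EuclideanSpace.norm_sq_eq]
    exact Fintype.sum_of_injective e he _ _ (fun q hq => by rw [hsupp q hq]; simp) fun p => rfl
  have hFx : ∀ p, Matrix.toEuclideanLin (F.submatrix e e) x p = Matrix.toEuclideanLin F y (e p) :=
      by
    intro p
    rw [toEuclideanLin_apply_apply, toEuclideanLin_apply_apply]
    exact Fintype.sum_of_injective e he _ _ (fun q hq => by rw [hsupp q hq]; simp) fun p => rfl
  have hxn : ‖x‖ = ‖y‖ := (pow_left_inj₀ (norm_nonneg _) (norm_nonneg _) two_ne_zero).1 hx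
  refine sval_le_of_norm_le (x := x) (fun h0 => hy ?_) ?_
  · rw [← norm_eq_zero, ← hxn, h0, norm_zero]
  · rw [← abs_of_nonneg (norm_nonneg (Matrix.toEuclideanLin (F.submatrix e e) x)), hxn]
    refine abs_le_of_sq_le_sq ?_ (by positivity)
    rw [EuclideanSpace.norm_sq_eq, mul_pow]
    simpa only [hFx] using h

end submatrix

section blocks

open SpecIncl

variable {N : ℕ} {m : Fin N → ℕ} (a : ∀ i j : Fin N, Matrix (Fin (m i)) (Fin (m j)) ℂ)

/-- The one-based block index of a coordinate of a block vector. -/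
def blockLevel (m : Fin N → ℕ) (q : (i : Fin N) × Fin (m i)) : ℕ := q.1 + 1

theorem blockLevel_mem (q : (i : Fin N) × Fin (m i)) :
    1 ≤ blockLevel m q ∧ blockLevel m q ≤ N :=
  ⟨Nat.succ_pos _, q.1.isLt⟩

theorem isLevelTridiagonal_sub_smul (z : ℂ) :
    IsLevelTridiagonal (blockLevel m) (blockMat m (triPart a) - z • 1) := by
  intro p q h
  by_contra hpq
  refine h ?_
  simp only [blockLevel] at hpq
  have hne : p ≠ q := by rintro rfl; omega
  have habs : ¬|(p.1 : ℤ) - (q.1 : ℤ)| ≤ 1 := by rw [abs_le]; omega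
  simp [blockMat, triPart, hne, habs]

theorem norm_levelProj_blockLevel (i : Fin N) (x : EuclideanSpace ℂ ((i : Fin N) × Fin (m i))) :
    ‖levelProj (blockLevel m) (i + 1) x‖
      = ‖(WithLp.toLp 2 fun c => x ⟨i, c⟩ : EuclideanSpace ℂ (Fin (m i)))‖ := by
  rw [← pow_left_inj₀ (norm_nonneg _) (norm_nonneg _) two_ne_zero, EuclideanSpace.norm_sq_eq,
    EuclideanSpace.norm_sq_eq, Fintype.sum_sigma, sum_eq_single i]
  · simp [levelProj_apply, blockLevel]
  · intro j _ hj
    have : (j : ℕ) ≠ i := fun h => hj (Fin.ext h)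
    simp [levelProj_apply, blockLevel, this]
  · simp

theorem norm_levelProj_offDiagonal_le {b : ∀ i j : Fin N, Matrix (Fin (m i)) (Fin (m j)) ℂ}
    (z : ℂ) {i j : Fin N} (hij : i ≠ j) (x : EuclideanSpace ℂ ((i : Fin N) × Fin (m i))) :
    ‖levelProj (blockLevel m) (i + 1) (Matrix.toEuclideanLin (blockMat m b - z • 1)
      (levelProj (blockLevel m) (j + 1) x))‖
      ≤ opNorm (b i j) * ‖levelProj (blockLevel m) (j + 1) x‖ := by
  rw [norm_levelProj_blockLevel, norm_levelProj_blockLevel]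
  refine le_trans (le_of_eq ?_) (norm_toEuclideanLin_le (b i j) _)
  congr 1
  ext c
  rw [toEuclideanLin_apply_apply, Fintype.sum_sigma, sum_eq_single j]
  · have : ∀ d : Fin (m j), (⟨i, c⟩ : (i : Fin N) × Fin (m i)) ≠ ⟨j, d⟩ :=
      fun d h => hij (congrArg Sigma.fst h)
    simp [levelProj_apply, blockLevel, blockMat, this, Matrix.mulVec, dotProduct]
  · intro k _ hk
    have : (k : ℕ) ≠ j := fun h => hk (Fin.ext h)
    simp [levelProj_apply, blockLevel, this]
  · simp

theorem finite_setOf_opNorm (P : Fin N → Fin N → Prop) :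
    {y : ℝ | ∃ i j : Fin N, P i j ∧ y = opNorm (a i j)}.Finite := by
  refine (Set.finite_range fun p : Fin N × Fin N => opNorm (a p.1 p.2)).subset ?_
  rintro y ⟨i, j, -, rfl⟩
  exact ⟨(i, j), rfl⟩

theorem opNorm_le_rL {i j : Fin N} (h : (j : ℕ) + 1 = i) : opNorm (a i j) ≤ rL a :=
  le_csSup (finite_setOf_opNorm a fun i j => (j : ℕ) + 1 = i).bddAbove ⟨i, j, h, rfl⟩

theorem opNorm_le_rU {i j : Fin N} (h : (i : ℕ) + 1 = j) : opNorm (a i j) ≤ rU a :=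
  le_csSup (finite_setOf_opNorm a fun i j => (i : ℕ) + 1 = j).bddAbove ⟨i, j, h, rfl⟩

theorem rL_nonneg : 0 ≤ rL a :=
  Real.sSup_nonneg (by rintro y ⟨i, j, -, rfl⟩; exact opNorm_nonneg _)

theorem rU_nonneg : 0 ≤ rU a :=
  Real.sSup_nonneg (by rintro y ⟨i, j, -, rfl⟩; exact opNorm_nonneg _)

theorem norm_levelProj_succ_le (z : ℂ) (i : ℕ)
    (x : EuclideanSpace ℂ ((i : Fin N) × Fin (m i))) :
    ‖levelProj (blockLevel m) (i + 1) (Matrix.toEuclideanLin (blockMat m (triPart a) - z • 1)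
      (levelProj (blockLevel m) i x))‖ ≤ rL a * ‖levelProj (blockLevel m) i x‖ := by
  by_cases h : 1 ≤ i ∧ i < N
  · obtain ⟨j, rfl⟩ : ∃ j, i = j + 1 := ⟨i - 1, by omega⟩
    refine (norm_levelProj_offDiagonal_le z (i := ⟨j + 1, h.2⟩) (j := ⟨j, by omega⟩)
      (by simp) x).trans (mul_le_mul_of_nonneg_right ?_ (norm_nonneg _))
    rw [triPart, if_pos (by simp)]
    exact opNorm_le_rL a rfl
  · obtain h | h : i = 0 ∨ N ≤ i := by omega
    · rw [levelProj_eq_zero (i := i) (fun q hq => by have := blockLevel_mem q; omega) x]; simp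
    · rw [levelProj_eq_zero (i := i + 1) (fun q hq => by have := blockLevel_mem q; omega),
        norm_zero]
      exact mul_nonneg (rL_nonneg a) (norm_nonneg _)

theorem norm_levelProj_pred_le (z : ℂ) (i : ℕ)
    (x : EuclideanSpace ℂ ((i : Fin N) × Fin (m i))) :
    ‖levelProj (blockLevel m) i (Matrix.toEuclideanLin (blockMat m (triPart a) - z • 1)
      (levelProj (blockLevel m) (i + 1) x))‖ ≤ rU a * ‖levelProj (blockLevel m) (i + 1) x‖ := by
  by_cases h : 1 ≤ i ∧ i < N
  · obtain ⟨j, rfl⟩ : ∃ j, i = j + 1 := ⟨i - 1, by omega⟩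
    refine (norm_levelProj_offDiagonal_le z (i := ⟨j, by omega⟩) (j := ⟨j + 1, h.2⟩)
      (by simp) x).trans (mul_le_mul_of_nonneg_right ?_ (norm_nonneg _))
    rw [triPart, if_pos (by simp)]
    exact opNorm_le_rU a rfl
  · obtain h | h : i = 0 ∨ N ≤ i := by omega
    · rw [levelProj_eq_zero (i := i) (fun q hq => by have := blockLevel_mem q; omega), norm_zero]
      exact mul_nonneg (rU_nonneg a) (norm_nonneg _)
    · rw [levelProj_eq_zero (i := i + 1) (fun q hq => by have := blockLevel_mem q; omega) x]; simp

theorem mem_pspec_window {b : ∀ i j : Fin N, Matrix (Fin (m i)) (Fin (m j)) ℂ} {z : ℂ}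
    {lo len : ℕ} (h : lo + len ≤ N) {σ : ℝ} (hσ : 0 ≤ σ)
    (hw : HasWindowVector (blockLevel m) (blockMat m b - z • 1) lo len σ) :
    z ∈ pspec σ (window b len lo h) := by
  obtain ⟨y, hy, hsupp, hle⟩ := hw
  let e : ((i : Fin len) × Fin (m (widx h i))) → (i : Fin N) × Fin (m i) :=
    fun p => ⟨widx h p.1, p.2⟩
  have he : Function.Injective e := by
    rintro ⟨i, c⟩ ⟨j, d⟩ hij
    simp only [e, Sigma.mk.injEq] at hij
    obtain rfl : i = j := by
      have := congrArg Fin.val hij.1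
      simp only [widx] at this
      exact Fin.ext (by omega)
    rw [eq_of_heq hij.2]
  have hrange : ∀ q, lo < blockLevel m q ∧ blockLevel m q ≤ lo + len ↔ q ∈ Set.range e := by
    rintro ⟨i, c⟩
    simp only [blockLevel]
    constructor
    · rintro ⟨h1, h2⟩
      obtain ⟨j, rfl⟩ : ∃ j : Fin len, widx h j = i :=
        ⟨⟨i - lo, by omega⟩, Fin.ext (by simp only [widx]; omega)⟩
      exact ⟨⟨j, c⟩, rfl⟩
    · rintro ⟨⟨j, d⟩, hj⟩
      have := congrArg (fun q => (q.1 : ℕ)) hj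
      simp only [e, widx] at this
      have := j.isLt
      omega
  have hsub : window b len lo h - z • 1 = (blockMat m b - z • 1).submatrix e e := by
    rw [Matrix.submatrix_sub, Matrix.submatrix_smul]
    simp only [Pi.sub_apply, Pi.smul_apply, Matrix.submatrix_one e he]
    rfl
  rw [pspec, Set.mem_ofPred_eq, hsub]
  refine sval_submatrix_le _ he hy (fun q hq => ?_) hσ (le_trans (le_of_eq ?_) hle)
  · by_contra h0
    exact hq ((hrange q).1 (hsupp q h0))
  · refine Fintype.sum_of_injective e he _ _ (fun q hq => ?_) fun p => ?_
    · rw [if_neg fun hq' => hq ((hrange q).1 hq')]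
    · rw [if_pos ((hrange _).2 ⟨p, rfl⟩)]

theorem blockMat_triPart_add_remPart :
    blockMat m a = blockMat m (triPart a) + blockMat m (remPart a) := by
  ext p q
  simp only [blockMat, triPart, remPart, Matrix.add_apply]
  split_ifs <;> simp

theorem sval_triPart_le [Nonempty ((i : Fin N) × Fin (m i))] {ε : ℝ} {z : ℂ}
    (hz : z ∈ pspec ε (blockMat m a)) :
    sval (blockMat m (triPart a) - z • 1) ≤ ε + opNorm (blockMat m (remPart a)) := by
  rw [pspec, Set.mem_ofPred_eq] at hz
  obtain ⟨x, hx, hFx, -⟩ := exists_norm_eq_sval (blockMat m a - z • 1)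
  refine sval_le_of_norm_le (x := x) (fun h0 => by simp [h0] at hx) ?_
  have e : blockMat m (triPart a) - z • 1
      = (blockMat m a - z • 1) - blockMat m (remPart a) := by
    rw [blockMat_triPart_add_remPart a]; abel
  rw [e, map_sub, LinearMap.sub_apply, hx, mul_one]
  refine (norm_sub_le _ _).trans (add_le_add (hFx.le.trans hz) ?_)
  simpa [hx] using norm_toEuclideanLin_le (blockMat m (remPart a)) x

end blocks

section inclusions

open SpecIncl

variable {N : ℕ} {m : Fin N → ℕ} (a : ∀ i j : Fin N, Matrix (Fin (m i)) (Fin (m j)) ℂ)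

theorem sin_theta_half_nonneg {rl ru : ℝ} (hrl : 0 ≤ rl) (hru : 0 ≤ ru) {n : ℕ} (hn : 1 ≤ n) :
    0 ≤ Real.sin (theta (rl * ru / (rl + ru) ^ 2) n / 2) := by
  obtain ⟨⟨hl, hu⟩, -⟩ := theta_spec (c := rl * ru / (rl + ru) ^ 2) (by positivity)
    (div_le_of_le_mul₀ (sq_nonneg _) (by norm_num) (by nlinarith [sq_nonneg (rl - ru)])) hn
  have hpi := Real.pi_pos
  have h1 : Real.pi / ((n : ℝ) + 2) ≤ Real.pi :=
    div_le_self hpi.le (by linarith [n.cast_nonneg (α := ℝ)])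
  have h2 : 0 ≤ Real.pi / (2 * (n : ℝ) + 1) := by positivity
  exact Real.sin_nonneg_of_nonneg_of_le_pi (by linarith) (by linarith)

theorem pspec_mono {ι : Type*} [Fintype ι] [DecidableEq ι] (E : Matrix ι ι ℂ) {δ ε : ℝ}
    (h : δ ≤ ε) : pspec δ E ⊆ pspec ε E :=
  fun _ hz => le_trans hz h

variable {a} {ε : ℝ} {z : ℂ}

theorem sval_add_le_epsTau [Nonempty ((i : Fin N) × Fin (m i))]
    (hz : z ∈ pspec ε (blockMat m a)) (n : ℕ) :
    sval (blockMat m (triPart a) - z • 1)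
      + 2 * (rL a + rU a) * Real.sin (theta (rL a * rU a / (rL a + rU a) ^ 2) n / 2)
      ≤ ε + epsTau a n := by
  have := sval_triPart_le a hz
  rw [epsTau, rA]
  linarith

theorem exists_hasWindowVector_of_rA_eq_zero [Nonempty ((i : Fin N) × Fin (m i))]
    (h : rL a + rU a = 0) (z : ℂ) {n : ℕ} (hn : 1 ≤ n) (hnN : n ≤ N) :
    ∃ k, k + n ≤ N ∧ HasWindowVector (blockLevel m) (blockMat m (triPart a) - z • 1) k n
      (sval (blockMat m (triPart a) - z • 1)) := by
  have hl := rL_nonneg a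
  have hu := rU_nonneg a
  refine exists_hasWindowVector_of_diagonal blockLevel_mem (isLevelTridiagonal_sub_smul a z)
    (fun i x => norm_le_zero_iff.1 ?_) (fun i x => norm_le_zero_iff.1 ?_) hn hnN
  · simpa [show rL a = 0 by linarith] using norm_levelProj_succ_le a z i x
  · simpa [show rU a = 0 by linarith] using norm_levelProj_pred_le a z i x

theorem mem_sigmaLow [Nonempty ((i : Fin N) × Fin (m i))] (hz : z ∈ pspec ε (blockMat m a))
    {n : ℕ} (hn : 1 ≤ n) (hnN : n ≤ N) : z ∈ sigmaLow a n hnN ε := by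
  obtain ⟨lo, len, hN, hlen, hcases, hw⟩ : ∃ lo len, lo + len ≤ N ∧ 1 ≤ len ∧
      (len = n ∨ len < n ∧ (lo = 0 ∨ lo + len = N)) ∧
      HasWindowVector (blockLevel m) (blockMat m (triPart a) - z • 1) lo len
        (sval (blockMat m (triPart a) - z • 1)
          + 2 * (rL a + rU a) * Real.sin (theta (rL a * rU a / (rL a + rU a) ^ 2) n / 2)) := by
    rcases (add_nonneg (rL_nonneg a) (rU_nonneg a)).eq_or_lt with h | h
    · obtain ⟨k, hk, hw⟩ := exists_hasWindowVector_of_rA_eq_zero h.symm z hn hnN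
      exact ⟨k, n, hk, hn, Or.inl rfl, by simpa [← h] using hw⟩
    · exact exists_hasWindowVector_of_truncation blockLevel_mem (isLevelTridiagonal_sub_smul a z)
        (rL_nonneg a) (rU_nonneg a) h (norm_levelProj_succ_le a z) (norm_levelProj_pred_le a z)
        hn hnN
  have hmem := pspec_mono _ (sval_add_le_epsTau hz n) (mem_pspec_window hN (add_nonneg
    (sval_nonneg _) (mul_nonneg (mul_nonneg zero_le_two (add_nonneg (rL_nonneg a) (rU_nonneg a)))
      (sin_theta_half_nonneg (rL_nonneg a) (rU_nonneg a) hn))) hw)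
  rcases hcases with rfl | ⟨hlt, h0⟩
  · exact Or.inl (Set.mem_iUnion.2 ⟨⟨lo, by omega⟩, hmem⟩)
  · obtain ⟨l, rfl⟩ : ∃ l, len = l + 1 := ⟨len - 1, by omega⟩
    refine Or.inr (Set.mem_iUnion.2 ⟨⟨l, by omega⟩, ?_⟩)
    rcases h0 with rfl | h0
    · exact Or.inl hmem
    · obtain rfl : lo = N - (l + 1) := by omega
      exact Or.inr hmem

theorem mem_sigmaHat [Nonempty ((i : Fin N) × Fin (m i))] (hz : z ∈ pspec ε (blockMat m a))
    {n : ℕ} (hn : 2 < n) (hnN : n < N) : z ∈ sigmaHat a n hnN.le ε := by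
  obtain ⟨p, rfl⟩ : ∃ p, n = p + 2 := ⟨n - 2, by omega⟩
  have hp : 1 ≤ p := by omega
  obtain ⟨k, hk, hw⟩ : ∃ k, k + (p + 2) ≤ N ∧
      HasWindowVector (blockLevel m) (blockMat m (triPart a) - z • 1) k (p + 2)
        (sval (blockMat m (triPart a) - z • 1)
          + 2 * (rL a + rU a) * Real.sin (theta (rL a * rU a / (rL a + rU a) ^ 2) p / 2)) := by
    rcases (add_nonneg (rL_nonneg a) (rU_nonneg a)).eq_or_lt with h | h
    · obtain ⟨k, hk, hw⟩ := exists_hasWindowVector_of_rA_eq_zero h.symm z (by omega) hnN.le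
      exact ⟨k, hk, by simpa [← h] using hw⟩
    · exact exists_hasWindowVector_of_cutoff blockLevel_mem (isLevelTridiagonal_sub_smul a z)
        (rL_nonneg a) (rU_nonneg a) h (norm_levelProj_succ_le a z) (norm_levelProj_pred_le a z)
        hp hnN
  exact Set.mem_iUnion.2 ⟨⟨k, by omega⟩, pspec_mono _ (sval_add_le_epsTau hz p)
    (mem_pspec_window hk (add_nonneg (sval_nonneg _) (mul_nonneg (mul_nonneg zero_le_two
      (add_nonneg (rL_nonneg a) (rU_nonneg a)))
      (sin_theta_half_nonneg (rL_nonneg a) (rU_nonneg a) hp))) hw)⟩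

end inclusions

end auxiliary

open SpecIncl in
/-- **Theorem 1.1 (the τ-method inclusion sets).** For every ε ≥ 0 and
n ∈ {1,…,N−1}, `Spec_ε A ⊆ Σ^n_ε(A)`; in particular (taking ε = 0)
`Spec A ⊆ Σ^n_0(A)`. -/
theorem tau_method_inclusion {N : ℕ} (hN : 1 < N) {m : Fin N → ℕ}
    (hm : ∀ i, 0 < m i)
    (a : ∀ i j : Fin N, Matrix (Fin (m i)) (Fin (m j)) ℂ)
    (ε : ℝ) (hε : 0 ≤ ε) (n : ℕ) (hn : 1 ≤ n) (hnN : n ≤ N - 1) :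
    pspec ε (blockMat m a) ⊆ SigmaTau a n (by omega) ε := by
  have : Nonempty ((i : Fin N) × Fin (m i)) := ⟨⟨⟨0, by omega⟩, ⟨0, hm _⟩⟩⟩
  intro z hz
  unfold SigmaTau
  split_ifs with h
  · exact mem_sigmaLow hz hn _
  · exact ⟨mem_sigmaLow hz hn _, mem_sigmaHat hz (by omega) (by omega)⟩
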